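/- arXiv:1301.2852 — 2 statements merged into one kernel-verified Lean document; each statement's English description precedes it below -/
import Mathlib

section
/- Let X be a separable real Banach space, let K ⊆ X be a closed convex cone with nonempty interior, let V ⊆ X be a nonempty open set, and let f : V → ℝ be K-nondecreasing on V. Then there exists an Aronszajn null set N ⊆ X such that f is Hadamard differentiable at every point of V \ N. -/
open Filter Topology Set MeasureTheory

/-- `f` is quasiconvex: `f (l•x + (1-l)•y) ≤ max (f x) (f y)` for `l ∈ [0,1]`. -/
def QuasiconvexFun {X : Type*} [AddCommGroup X] [Module ℝ X] (f : X → ℝ) : Prop :=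
  ∀ x y : X, ∀ l : ℝ, l ∈ Set.Icc (0 : ℝ) 1 →
    f (l • x + (1 - l) • y) ≤ max (f x) (f y)

/-- `f` is strictly quasiconvex. -/
def StrictlyQuasiconvexFun {X : Type*} [AddCommGroup X] [Module ℝ X] (f : X → ℝ) : Prop :=
  ∀ x y : X, x ≠ y → ∀ l : ℝ, l ∈ Set.Ioo (0 : ℝ) 1 →
    f (l • x + (1 - l) • y) < max (f x) (f y)

/-- `f` is densely continuous: its set of points of continuity is dense. -/
def DenselyContinuous {X : Type*} [TopologicalSpace X] (f : X → ℝ) : Prop :=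
  Dense {x : X | ContinuousAt f x}

/-- `m` is the topological essential infimum of `f`: the strict sublevel set `{f < α}`
is meager for `α < m` and nonmeager for `α > m`. -/
def IsTopEssInf {X : Type*} [TopologicalSpace X] (f : X → ℝ) (m : ℝ) : Prop :=
  (∀ α : ℝ, α < m → IsMeagre {x : X | f x < α}) ∧
  (∀ α : ℝ, m < α → ¬ IsMeagre {x : X | f x < α})

/-- Aronszajn null set: a Borel set `N` such that for every sequence `ξ` with dense linear
span, `N` decomposes as a countable union of Borel sets, the `n`-th of which has Lebesgue
null intersection with every line of direction `ξ n`. -/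
def AronszajnNull {X : Type*} [NormedAddCommGroup X] [NormedSpace ℝ X]
    [MeasurableSpace X] (N : Set X) : Prop :=
  MeasurableSet N ∧
  ∀ ξ : ℕ → X, Dense (Submodule.span ℝ (Set.range ξ) : Set X) →
    ∃ Nn : ℕ → Set X, N = ⋃ n, Nn n ∧
      ∀ n, MeasurableSet (Nn n) ∧
        ∀ x : X, MeasureTheory.volume {t : ℝ | x + t • ξ n ∈ Nn n} = 0

/-- Haar null set: `E` is contained in a Borel set `B` for which there is a Borel
probability measure vanishing on all translates of `B`. -/
def HaarNull {X : Type*} [AddCommGroup X] [TopologicalSpace X]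
    [MeasurableSpace X] (E : Set X) : Prop :=
  ∃ B : Set X, E ⊆ B ∧ MeasurableSet B ∧
    ∃ μ : MeasureTheory.Measure X, MeasureTheory.IsProbabilityMeasure μ ∧
      ∀ x : X, μ ((fun y => x + y) '' B) = 0

/-- Hadamard differentiability of `f` at `x`. -/
def HadamardDiffAt {X : Type*} [NormedAddCommGroup X] [NormedSpace ℝ X]
    (f : X → ℝ) (x : X) : Prop :=
  ∃ L : X →L[ℝ] ℝ, ∀ h : X, ∀ t : ℕ → ℝ, (∀ n, t n ≠ 0) →
    Tendsto t atTop (𝓝 0) → ∀ hs : ℕ → X, Tendsto hs atTop (𝓝 h) →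
      Tendsto (fun n => (f (x + t n • hs n) - f x) / t n) atTop (𝓝 (L h))

/-- Hadamard differentiability at `x` of a function whose relevant values are those on `V`. -/
def HadamardDiffWithinAt {X : Type*} [NormedAddCommGroup X] [NormedSpace ℝ X]
    (f : X → ℝ) (V : Set X) (x : X) : Prop :=
  ∃ L : X →L[ℝ] ℝ, ∀ h : X, ∀ t : ℕ → ℝ, (∀ n, t n ≠ 0) →
    Tendsto t atTop (𝓝 0) → ∀ hs : ℕ → X, Tendsto hs atTop (𝓝 h) →
      (∀ n, x + t n • hs n ∈ V) →
      Tendsto (fun n => (f (x + t n • hs n) - f x) / t n) atTop (𝓝 (L h))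

/-- Gâteaux differentiability of `f` at `x` with derivative `L`. -/
def GateauxDiffAt {X : Type*} [NormedAddCommGroup X] [NormedSpace ℝ X]
    (f : X → ℝ) (x : X) (L : X →L[ℝ] ℝ) : Prop :=
  ∀ h : X, Tendsto (fun t : ℝ => (f (x + t • h) - f x) / t) (𝓝[≠] 0) (𝓝 (L h))

/-- Essential Gâteaux differentiability of `f` at `x`: directional derivatives exist and
are given by a continuous linear functional for a comeager (residual) set of directions
in the unit sphere. -/
def EssGateauxDiffAt {X : Type*} [NormedAddCommGroup X] [NormedSpace ℝ X]
    (f : X → ℝ) (x : X) : Prop :=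
  ∃ L : X →L[ℝ] ℝ, ∃ Ω : Set (Metric.sphere (0 : X) 1), IsMeagre Ωᶜ ∧
    ∀ h ∈ Ω, Tendsto (fun t : ℝ => (f (x + t • (h : X)) - f x) / t) (𝓝[≠] 0) (𝓝 (L (h : X)))

/-- `K` is a closed convex cone. -/
def IsClosedConvexCone {X : Type*} [NormedAddCommGroup X] [NormedSpace ℝ X] (K : Set X) : Prop :=
  IsClosed K ∧ Convex ℝ K ∧ ∀ l : ℝ, 0 ≤ l → ∀ k ∈ K, l • k ∈ K

/-- `f` is `K`-nondecreasing on `U`. -/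
def KNondecreasingOn {X : Type*} [AddCommGroup X] [Module ℝ X]
    (f : X → ℝ) (K U : Set X) : Prop :=
  ∀ u ∈ U, ∀ k ∈ K, k ≠ 0 → u + k ∈ U → f u ≤ f (u + k)

/-- Ideally convex subset: stable under infinite convex combinations of bounded sequences. -/
def IdeallyConvex {X : Type*} [NormedAddCommGroup X] [NormedSpace ℝ X] (C : Set X) : Prop :=
  ∀ (x : ℕ → X) (lam : ℕ → ℝ), (∀ n, x n ∈ C) → Bornology.IsBounded (Set.range x) →
    (∀ n, lam n ∈ Set.Icc (0 : ℝ) 1) → HasSum lam 1 →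
      ∑' n, lam n • x n ∈ C

/-- `C‡`: the union, over finite dimensional subspaces `Z ⊆ X`, of the closures of `C ∩ Z`. -/
def Ddag {X : Type*} [NormedAddCommGroup X] [NormedSpace ℝ X] (C : Set X) : Set X :=
  ⋃ (Z : Submodule ℝ X) (_ : FiniteDimensional ℝ Z), closure (C ∩ (Z : Set X))

/-- A normed space is reflexive if the canonical inclusion into its double dual is onto. -/
def IsReflexiveSpace (X : Type*) [NormedAddCommGroup X] [NormedSpace ℝ X] : Prop :=
  Function.Surjective (NormedSpace.inclusionInDoubleDual ℝ X)


/-- Domination form of cone monotonicity. -/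
def DomMono {X : Type*} [NormedAddCommGroup X] [NormedSpace ℝ X] (f : X → ℝ) (e : X) : Prop :=
  ∀ x y : X, ∀ s : ℝ, ‖y‖ ≤ s → f x ≤ f (x + s • e + y)

/-- Lipschitz reparametrisation of the graph of `F`. -/
noncomputable def cphi {X : Type*} [NormedAddCommGroup X] [NormedSpace ℝ X]
    (F : X → ℝ) (e : X) (z : X) : ℝ := sSup {s : ℝ | s ≤ F (z - s • e)}

section fin
variable {X : Type*} [NormedAddCommGroup X] [NormedSpace ℝ X] {F : X → ℝ} {e : X} {B : ℝ}

lemma DomMono.along (hm : DomMono F e) (x : X) {s : ℝ} (hs : 0 ≤ s) : F x ≤ F (x + s • e) := by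
  simpa using hm x 0 s (by simpa using hs)

lemma cphi_bdd (hB : ∀ x, |F x| ≤ B) (z : X) : BddAbove {s : ℝ | s ≤ F (z - s • e)} :=
  ⟨B, fun _ hs => le_trans hs (le_trans (le_abs_self _) (hB _))⟩

lemma cphi_nonempty (hB : ∀ x, |F x| ≤ B) (z : X) : {s : ℝ | s ≤ F (z - s • e)}.Nonempty :=
  ⟨-B, (abs_le.1 (hB _)).1⟩

lemma le_cphi (hB : ∀ x, |F x| ≤ B) {z : X} {s : ℝ} (hs : s ≤ F (z - s • e)) : s ≤ cphi F e z :=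
  le_csSup (cphi_bdd hB z) hs

lemma of_lt_cphi (hm : DomMono F e) (hB : ∀ x, |F x| ≤ B) {z : X} {s : ℝ}
    (hs : s < cphi F e z) : s ≤ F (z - s • e) := by
  obtain ⟨s', hs', h⟩ := exists_lt_of_lt_csSup (cphi_nonempty hB z) hs
  have h1 : s' ≤ F (z - s' • e) := hs'
  have h2 := hm.along (z - s' • e) (sub_nonneg.2 h.le)
  rw [show z - s' • e + (s' - s) • e = z - s • e by module] at h2
  linarith

lemma cphi_le (hB : ∀ x, |F x| ≤ B) {z : X} {c : ℝ} (h : ∀ s, s ≤ F (z - s • e) → s ≤ c) :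
    cphi F e z ≤ c := csSup_le (cphi_nonempty hB z) h

lemma cphi_lip (hm : DomMono F e) (hB : ∀ x, |F x| ≤ B) : LipschitzWith 1 (cphi F e) := by
  refine LipschitzWith.of_le_add fun z z' => ?_
  refine cphi_le hB fun s hs => ?_
  have hd : 0 ≤ dist z z' := dist_nonneg
  have : s - dist z z' ≤ cphi F e z' := by
    refine le_cphi hB ?_
    have h2 := hm (z - s • e) (z' - z) (dist z z') (by rw [dist_comm, dist_eq_norm])
    rw [show z - s • e + dist z z' • e + (z' - z) = z' - (s - dist z z') • e by module] at h2
    linarith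
  linarith

lemma cphi_add_le (hB : ∀ x, |F x| ≤ B) (z : X) {d : ℝ} (hd : 0 ≤ d) :
    cphi F e (z + d • e) ≤ cphi F e z + d := by
  refine cphi_le hB fun s hs => ?_
  have : s - d ≤ cphi F e z := by
    refine le_cphi hB ?_
    rw [show z - (s - d) • e = z + d • e - s • e by module]
    linarith
  linarith

lemma cphi_graph (hm : DomMono F e) (hB : ∀ x, |F x| ≤ B) (x : X) :
    cphi F e (x + F x • e) = F x := by
  apply le_antisymm
  · refine cphi_le hB fun s hs => ?_
    by_contra hlt
    push Not at hlt
    have h2 := hm.along (x + F x • e - s • e) (sub_nonneg.2 hlt.le)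
    rw [show x + F x • e - s • e + (s - F x) • e = x by module] at h2
    linarith
  · refine le_cphi hB ?_
    simp

/-- continuity from sequences along `e` -/
lemma DomMono.continuousAt (hm : DomMono F e) {x : X}
    (h1 : ∀ r > 0, ∃ η : ℝ, 0 < η ∧ F (x + η • e) < F x + r)
    (h2 : ∀ r > 0, ∃ η : ℝ, 0 < η ∧ F x - r < F (x - η • e)) : ContinuousAt F x := by
  rw [Metric.continuousAt_iff]
  intro r hr
  obtain ⟨η, hη, h1⟩ := h1 r hr
  obtain ⟨η', hη', h2⟩ := h2 r hr
  refine ⟨min η η', lt_min hη hη', fun {y} hy => ?_⟩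
  rw [dist_eq_norm] at hy
  have a1 := hm y (x - y) η (by rw [norm_sub_rev]; exact hy.le.trans (min_le_left _ _))
  have a2 := hm (x - η' • e) (y - x) η' (hy.le.trans (min_le_right _ _))
  rw [show y + η • e + (x - y) = x + η • e by module] at a1
  rw [show x - η' • e + η' • e + (y - x) = y by module] at a2
  rw [Real.dist_eq, abs_lt]
  constructor <;> linarith

/-- key differentiability step -/
lemma diff_of_cphi (hm : DomMono F e) (hB : ∀ x, |F x| ≤ B) {x : X} {A : X →L[ℝ] ℝ}
    (hA : HasFDerivAt (cphi F e) A (x + F x • e)) (hAe : A e ≠ 1) : DifferentiableAt ℝ F x := by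
  set z := x + F x • e with hz
  have hzx : cphi F e z = F x := cphi_graph hm hB x
  -- one-dimensional restriction
  have h1d : HasDerivAt (fun r : ℝ => cphi F e (z + r • e)) (A e) 0 := by
    have hl : HasDerivAt (fun r : ℝ => z + r • e) e 0 := by
      simpa using ((hasDerivAt_id (0 : ℝ)).smul_const e).const_add z
    have hA' : HasFDerivAt (cphi F e) A (z + (0 : ℝ) • e) := by simpa using hA
    exact hA'.comp_hasDerivAt (0 : ℝ) hl
  have hlim := h1d.tendsto_slope_zero
  have hR : Tendsto (fun t : ℝ => t⁻¹ • (cphi F e (z + (0 + t) • e) - cphi F e (z + (0 : ℝ) • e)))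
      (𝓝[>] 0) (𝓝 (A e)) := hlim.mono_left (nhdsWithin_mono _ (fun t ht => ne_of_gt ht))
  have hL : Tendsto (fun t : ℝ => t⁻¹ • (cphi F e (z + (0 + t) • e) - cphi F e (z + (0 : ℝ) • e)))
      (𝓝[<] 0) (𝓝 (A e)) := hlim.mono_left (nhdsWithin_mono _ (fun t ht => ne_of_lt ht))
  simp only [zero_add, zero_smul, add_zero, smul_eq_mul, hzx] at hR hL
  have hle : A e ≤ 1 := by
    refine le_of_tendsto hR ?_
    filter_upwards [self_mem_nhdsWithin] with t ht
    have ht : 0 < t := ht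
    have := cphi_add_le (e := e) hB z ht.le
    rw [inv_mul_le_iff₀ ht]
    linarith
  have hlt : A e < 1 := lt_of_le_of_ne hle hAe
  have hcont : ContinuousAt F x := by
    refine hm.continuousAt ?_ ?_
    · intro r hr
      have := (hR.eventually_lt_const hlt).and
        ((Ioo_mem_nhdsGT hr : Ioo 0 r ∈ 𝓝[>] (0:ℝ)))
      obtain ⟨t, ht, ht0, htr⟩ := this.exists
      rw [inv_mul_lt_iff₀ ht0] at ht
      obtain ⟨s, hs1, hs2⟩ := exists_between (show cphi F e (z + t • e) < F x + t by linarith)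
      refine ⟨F x + t - s, by linarith, ?_⟩
      by_contra hcon
      push Not at hcon
      have : s ≤ cphi F e (z + t • e) := by
        refine le_cphi hB ?_
        rw [show z + t • e - s • e = x + (F x + t - s) • e by rw [hz]; module]
        linarith
      linarith
    · intro r hr
      have := (hL.eventually_lt_const hlt).and
        ((Ioo_mem_nhdsLT (neg_lt_zero.2 hr) : Ioo (-r) 0 ∈ 𝓝[<] (0:ℝ)))
      obtain ⟨t, ht, htr, ht0⟩ := this.exists
      have ht' : F x + t < cphi F e (z + t • e) := by
        have h3 := mul_lt_mul_of_neg_left ht ht0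
        rw [← mul_assoc, mul_inv_cancel₀ ht0.ne] at h3
        linarith
      obtain ⟨s, hs1, hs2⟩ := exists_between ht'
      refine ⟨s - (F x + t), by linarith, ?_⟩
      have h4 := of_lt_cphi hm hB hs2
      rw [show z + t • e - s • e = x - (s - (F x + t)) • e by rw [hz]; module] at h4
      linarith
  -- now differentiability
  refine ⟨(1 - A e)⁻¹ • A, ?_⟩
  have hpos : 0 < 1 - A e := by linarith
  rw [hasFDerivAt_iff_isLittleO_nhds_zero]
  have hT : Tendsto (fun h : X => h + (F (x + h) - F x) • e) (𝓝 0) (𝓝 0) := by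
    have hc : Tendsto (fun h : X => F (x + h)) (𝓝 0) (𝓝 (F x)) := by
      have : Tendsto (fun h : X => x + h) (𝓝 0) (𝓝 x) := by
        simpa using (continuous_const_add x).tendsto (0 : X)
      exact hcont.tendsto.comp this
    have := (tendsto_id (α := X) (x := 𝓝 0)).add ((hc.sub_const (F x)).smul_const e)
    simpa using this
  have ho := (hasFDerivAt_iff_isLittleO_nhds_zero.1 hA).comp_tendsto hT
  rw [Asymptotics.isLittleO_iff] at ho ⊢
  intro c hc
  -- choose small constant
  set a := 1 - A e with ha
  set M := 1 + ‖e‖ + ‖A‖ with hM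
  have hMpos : 0 < M := by positivity
  obtain ⟨c', hc'0, hc'1, hc'2⟩ : ∃ c' > 0, c' * ‖e‖ ≤ a / 2 ∧
      c' * (1 + ‖e‖ * (2 / a * (c' + ‖A‖))) ≤ c * a := by
    have hlim2 : Tendsto (fun c' : ℝ => c' * ‖e‖) (𝓝[>] 0) (𝓝 0) := by
      have : Continuous (fun c' : ℝ => c' * ‖e‖) := by fun_prop
      simpa using (this.tendsto 0).mono_left nhdsWithin_le_nhds
    have hlim3 : Tendsto (fun c' : ℝ => c' * (1 + ‖e‖ * (2 / a * (c' + ‖A‖)))) (𝓝[>] 0) (𝓝 0) := by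
      have : Continuous (fun c' : ℝ => c' * (1 + ‖e‖ * (2 / a * (c' + ‖A‖)))) := by fun_prop
      simpa using (this.tendsto 0).mono_left nhdsWithin_le_nhds
    have := ((hlim2.eventually_lt_const (show 0 < a / 2 by positivity)).and
      (hlim3.eventually_lt_const (show 0 < c * a by positivity))).and
        (self_mem_nhdsWithin (s := Ioi (0:ℝ)) (a := 0))
    obtain ⟨c', ⟨h1, h2⟩, h3⟩ := this.exists
    exact ⟨c', h3, h1.le, h2.le⟩
  filter_upwards [ho hc'0] with h hh
  simp only [Function.comp] at hh
  set Δ := F (x + h) - F x with hΔ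
  have hzz : z + (h + Δ • e) = (x + h) + F (x + h) • e := by rw [hz, hΔ]; module
  rw [hzz, cphi_graph hm hB, hzx] at hh
  have e1 : F (x + h) - F x - A (h + Δ • e) = a * Δ - A h := by
    simp only [map_add, map_smul, smul_eq_mul, ha, ← hΔ]; ring
  rw [e1, Real.norm_eq_abs] at hh
  have hw : ‖h + Δ • e‖ ≤ ‖h‖ + |Δ| * ‖e‖ := by
    refine (norm_add_le _ _).trans ?_
    rw [norm_smul, Real.norm_eq_abs]
  have hAh : |A h| ≤ ‖A‖ * ‖h‖ := A.le_opNorm h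
  have hx1 : |a * Δ - A h| ≤ c' * (‖h‖ + |Δ| * ‖e‖) :=
    hh.trans (mul_le_mul_of_nonneg_left hw hc'0.le)
  have hΔb : |Δ| ≤ 2 / a * (c' + ‖A‖) * ‖h‖ := by
    have h5 : a * |Δ| ≤ |a * Δ - A h| + |A h| := by
      rw [← abs_of_pos hpos, ← abs_mul, abs_of_pos hpos]
      simpa using abs_add_le (a * Δ - A h) (A h)
    have h6 : |Δ| * (c' * ‖e‖) ≤ |Δ| * (a / 2) := mul_le_mul_of_nonneg_left hc'1 (abs_nonneg _)
    have h7 : a / 2 * |Δ| ≤ (c' + ‖A‖) * ‖h‖ := by nlinarith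
    rw [mul_assoc, div_mul_eq_mul_div, le_div_iff₀ hpos]
    linarith
  have hfin : |a * Δ - A h| ≤ c * a * ‖h‖ := by
    refine hx1.trans ?_
    have h8 : ‖h‖ + |Δ| * ‖e‖ ≤ (1 + ‖e‖ * (2 / a * (c' + ‖A‖))) * ‖h‖ := by
      have := mul_le_mul_of_nonneg_right hΔb (norm_nonneg e)
      linarith
    have := mul_le_mul_of_nonneg_left h8 hc'0.le
    have h9 := mul_le_mul_of_nonneg_right hc'2 (norm_nonneg h)
    linarith
  have e2 : F (x + h) - F x - (a⁻¹ • A) h = a⁻¹ * (a * Δ - A h) := by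
    simp only [_root_.smul_apply, smul_eq_mul, ← hΔ]
    field_simp
  rw [e2, Real.norm_eq_abs, abs_mul, abs_of_pos (inv_pos.2 hpos), inv_mul_le_iff₀ hpos]
  linarith
end fin

lemma fin_ae_diff {n : ℕ} {F : (Fin n → ℝ) → ℝ} {e : Fin n → ℝ} {B : ℝ}
    (hm : DomMono F e) (hB : ∀ x, |F x| ≤ B) :
    ∀ᵐ x : Fin n → ℝ, DifferentiableAt ℝ F x := by
  set φ := cphi F e with hφ
  have hlip := cphi_lip hm hB
  let ψ : (Fin n → ℝ) → (Fin n → ℝ) := fun z => z - φ z • e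
  have hψ : ∃ C, LipschitzWith C ψ := by
    have h1 : LipschitzWith (‖e‖₊ * 1) (fun z => φ z • e) := by
      refine LipschitzWith.of_dist_le_mul fun z z' => ?_
      rw [dist_eq_norm, ← sub_smul, norm_smul, mul_comm]
      have := hlip.dist_le_mul z z'
      rw [dist_eq_norm] at this
      simp only [NNReal.coe_one, one_mul, coe_nnnorm, mul_one] at this ⊢
      exact mul_le_mul_of_nonneg_left this (norm_nonneg _)
    exact ⟨_, LipschitzWith.id.sub h1⟩
  obtain ⟨C, hψ⟩ := hψ
  have hae : ∀ᵐ z : Fin n → ℝ, DifferentiableAt ℝ φ z := hlip.ae_differentiableAt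
  set B1 := {z : Fin n → ℝ | ¬ DifferentiableAt ℝ φ z} with hB1
  set B2 := {z : Fin n → ℝ | DifferentiableAt ℝ φ z ∧ fderiv ℝ φ z e = 1} with hB2
  have n1 : volume (ψ '' B1) = 0 := by
    rw [← hausdorffMeasure_pi_real]
    have h := hψ.hausdorffMeasure_image_le (d := ((Fintype.card (Fin n) : ℕ) : ℝ)) (by positivity) B1
    rw [hausdorffMeasure_pi_real] at h ⊢
    rw [show volume B1 = 0 from hae, mul_zero] at h
    exact le_antisymm h bot_le
  have n2 : volume (ψ '' B2) = 0 := by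
    refine addHaar_image_eq_zero_of_det_fderivWithin_eq_zero volume
      (f' := fun z => ContinuousLinearMap.id ℝ _ - (fderiv ℝ φ z).smulRight e) ?_ ?_
    · intro z hz
      exact ((hasFDerivAt_id z).sub (hz.1.hasFDerivAt.smul_const e)).hasFDerivWithinAt
    · intro z hz
      by_contra hdet
      have hinj : Function.Injective ((ContinuousLinearMap.id ℝ (Fin n → ℝ) -
          (fderiv ℝ φ z).smulRight e : (Fin n → ℝ) →L[ℝ] (Fin n → ℝ)) :
            (Fin n → ℝ) →ₗ[ℝ] (Fin n → ℝ)) := by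
        exact (LinearMap.equivOfDetNeZero _ hdet).injective
      have he0 : e = 0 := hinj (by simp [hz.2])
      have := hz.2
      rw [he0] at this
      simp at this
  have hsub : {x | ¬ DifferentiableAt ℝ F x} ⊆ ψ '' B1 ∪ ψ '' B2 := by
    intro x hx
    have hx' : ψ (x + F x • e) = x := by
      simp only [ψ, hφ, cphi_graph hm hB]; simp
    by_cases hd : DifferentiableAt ℝ φ (x + F x • e)
    · right
      refine ⟨_, ⟨hd, ?_⟩, hx'⟩
      by_contra hne
      exact hx (diff_of_cphi hm hB hd.hasFDerivAt hne)
    · exact Or.inl ⟨_, hd, hx'⟩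
  exact measure_mono_null hsub (measure_union_null n1 n2)

section fub
variable {X : Type*} [NormedAddCommGroup X] [NormedSpace ℝ X]
  [TopologicalSpace.SeparableSpace X] [MeasurableSpace X] [BorelSpace X]

/-- decomposability of a set along a sequence of directions -/
def Decomp (ξ : ℕ → X) (A : Set X) : Prop :=
  ∃ Nn : ℕ → Set X, A = ⋃ n, Nn n ∧
      ∀ n, MeasurableSet (Nn n) ∧
        ∀ x : X, MeasureTheory.volume {t : ℝ | x + t • ξ n ∈ Nn n} = 0

lemma Decomp.mono {ξ : ℕ → X} {A B : Set X} (h : Decomp ξ B) (hA : MeasurableSet A) (hAB : A ⊆ B) :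
    Decomp ξ A := by
  obtain ⟨M, rfl, hM⟩ := h
  refine ⟨fun n => A ∩ M n, ?_, fun n => ⟨hA.inter (hM n).1, fun x => ?_⟩⟩
  · rw [← inter_iUnion, inter_eq_left.2 hAB]
  · exact measure_mono_null (fun t ht => ht.2) ((hM n).2 x)

lemma Decomp.iUnion {ι : Type*} [Countable ι] {ξ : ℕ → X} {A : ι → Set X}
    (h : ∀ i, Decomp ξ (A i)) : Decomp ξ (⋃ i, A i) := by
  choose M hM hM' using h
  refine ⟨fun n => ⋃ i, M i n, ?_, fun n => ⟨MeasurableSet.iUnion fun i => (hM' i n).1, fun x => ?_⟩⟩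
  · rw [iUnion_comm]
    exact iUnion_congr hM
  · have : {t : ℝ | x + t • ξ n ∈ ⋃ i, M i n} = ⋃ i, {t : ℝ | x + t • ξ n ∈ M i n} := by
      ext t; simp
    rw [this]
    exact measure_iUnion_null fun i => (hM' i n).2 x

lemma Decomp.single {ξ : ℕ → X} {A : Set X} (m : ℕ) (hA : MeasurableSet A)
    (h : ∀ x : X, MeasureTheory.volume {t : ℝ | x + t • ξ m ∈ A} = 0) : Decomp ξ A := by
  refine ⟨fun n => if n = m then A else ∅, ?_, fun n => ⟨?_, fun x => ?_⟩⟩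
  · ext x; simp
  · dsimp only
    split_ifs
    · exact hA
    · exact MeasurableSet.empty
  · by_cases hn : n = m
    · subst hn; simpa using h x
    · simp [hn]

lemma decomp_of_null (ξ : ℕ → X) (n : ℕ) : ∀ A : Set X, MeasurableSet A →
    (∀ x, volume {t : Fin n → ℝ | x + ∑ i, t i • ξ i ∈ A} = 0) → Decomp ξ A := by
  have : SecondCountableTopology X := UniformSpace.secondCountable_of_separable X
  induction n with
  | zero =>
    intro A hA h
    have : A = ∅ := by
      by_contra hne
      obtain ⟨x, hx⟩ := nonempty_iff_ne_empty.2 hne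
      have := h x
      simp only [Finset.univ_eq_empty, Finset.sum_empty, add_zero, hx, setOf_true] at this
      rw [volume_pi, Measure.pi_of_empty] at this
      simp at this
    subst this
    exact Decomp.single 0 hA (by simp)
  | succ n ih =>
    intro A hA h
    set B : Set X := {x | volume {s : ℝ | x + s • ξ n ∈ A} ≠ 0} with hB
    have hBm : MeasurableSet B := by
      have hs : MeasurableSet {p : X × ℝ | p.1 + p.2 • ξ n ∈ A} := by
        have : Measurable (fun p : X × ℝ => p.1 + p.2 • ξ n) :=
          (by fun_prop : Continuous (fun p : X × ℝ => p.1 + p.2 • ξ n)).measurable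
        exact this hA
      have := measurable_measure_prodMk_left (ν := (volume : Measure ℝ)) hs
      exact (this (measurableSet_singleton 0)).compl
    have d1 : Decomp ξ (A \ B) := by
      refine Decomp.single n (hA.diff hBm) fun x => ?_
      rcases eq_empty_or_nonempty {t : ℝ | x + t • ξ n ∈ A \ B} with h0 | ⟨t0, ht0⟩
      · rw [h0]; simp
      · have h1 : volume {s : ℝ | x + t0 • ξ n + s • ξ n ∈ A} = 0 := by
          simpa [hB] using ht0.2
        have h2 : {s : ℝ | x + t0 • ξ n + s • ξ n ∈ A} =
            (fun s => t0 + s) ⁻¹' {t : ℝ | x + t • ξ n ∈ A} := by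
          ext s; simp [add_smul, add_assoc]
        rw [h2, measure_preimage_add] at h1
        exact measure_mono_null (fun t ht => ht.1) h1
    have d2 : Decomp ξ B := by
      refine ih B hBm fun x => ?_
      have hx := h x
      have hmp := volume_preserving_piFinSuccAbove (fun _ : Fin (n + 1) => ℝ) (Fin.last n)
      have hset : MeasurableSet {p : ℝ × (Fin n → ℝ) |
          x + (∑ i, p.2 i • ξ i) + p.1 • ξ n ∈ A} := by
        have : Continuous (fun p : ℝ × (Fin n → ℝ) =>
          x + (∑ i, p.2 i • ξ i) + p.1 • ξ n) := by fun_prop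
        exact this.measurable hA
      have h3 : {t : Fin (n + 1) → ℝ | x + ∑ i, t i • ξ i ∈ A} =
          (MeasurableEquiv.piFinSuccAbove (fun _ : Fin (n + 1) => ℝ) (Fin.last n)) ⁻¹'
          {p : ℝ × (Fin n → ℝ) | x + (∑ i, p.2 i • ξ i) + p.1 • ξ n ∈ A} := by
        ext t
        simp [Fin.sum_univ_castSucc, add_assoc, Fin.init]
      rw [h3, hmp.measure_preimage hset.nullMeasurableSet, Measure.volume_eq_prod,
        Measure.prod_apply_symm hset,
        lintegral_eq_zero_iff (measurable_measure_prodMk_right hset)] at hx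
      have hx' : ∀ᵐ t : Fin n → ℝ, ¬ (x + ∑ i, t i • ξ i ∈ B) := by
        filter_upwards [hx] with t ht
        simpa [hB] using ht
      simpa [ae_iff] using hx'
    refine (Decomp.iUnion (ι := Bool) (A := fun b => if b then A \ B else B)
      (by intro b; cases b <;> simpa)).mono hA ?_
    intro x hx
    by_cases hxB : x ∈ B
    · exact mem_iUnion.2 ⟨false, by simpa using hxB⟩
    · exact mem_iUnion.2 ⟨true, by simpa using ⟨hx, hxB⟩⟩
end fub

section had
variable {X : Type*} [NormedAddCommGroup X] [NormedSpace ℝ X] {f g : X → ℝ} {e x : X}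

/-- discrete difference quotient -/
noncomputable def Qd (g : X → ℝ) (x d : X) (k : ℕ) : ℝ := (k : ℝ) * (g (x + (k : ℝ)⁻¹ • d) - g x)

/-- good behaviour at `x` in the directions `d`, `d'` -/
def GoodPair (f g : X → ℝ) (x d d' : X) : Prop :=
  ContinuousAt f x ∧ (∃ l, Tendsto (Qd g x d) atTop (𝓝 l)) ∧
    (∃ l, Tendsto (Qd g x d') atTop (𝓝 l)) ∧
    Tendsto (fun k => Qd g x (d + d') k - Qd g x d k - Qd g x d' k) atTop (𝓝 0)

/-- lower semicontinuous envelope, extended real version -/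
noncomputable def genv (f : X → ℝ) (x : X) : EReal :=
  open Classical in
  ⨆ a : ℚ, if x ∈ interior {y | (a : ℝ) < f y} then (((a : ℚ) : ℝ) : EReal) else ⊥

/-- lower semicontinuous envelope -/
noncomputable def genvR (f : X → ℝ) (x : X) : ℝ := (genv f x).toReal

lemma genv_le (f : X → ℝ) (x : X) : genv f x ≤ (f x : EReal) := by
  refine iSup_le fun a => ?_
  split_ifs with h
  · have hx : x ∈ {y | (a : ℝ) < f y} := interior_subset h
    have : (a : ℝ) < f x := hx
    exact_mod_cast this.le
  · exact bot_le

lemma le_genv (hm : DomMono f e) (y u : X) (s : ℝ) (hu : ‖u‖ < s) :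
    (f y : EReal) ≤ genv f (y + s • e + u) := by
  by_contra hcon
  push Not at hcon
  obtain ⟨a, ha1, ha2⟩ := EReal.lt_iff_exists_rat_btwn.1 hcon
  have ha : (a : ℝ) < f y := by exact_mod_cast ha2
  have hin : y + s • e + u ∈ interior {y | (a : ℝ) < f y} := by
    rw [mem_interior_iff_mem_nhds]
    refine mem_of_superset (Metric.ball_mem_nhds _ (sub_pos.2 hu)) fun w hw => ?_
    have hw' : ‖w - (y + s • e + u)‖ < s - ‖u‖ := by rwa [Metric.mem_ball, dist_eq_norm] at hw
    have h1 := hm y (u + (w - (y + s • e + u))) s (by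
      refine (norm_add_le _ _).trans ?_
      linarith)
    rw [show y + s • e + (u + (w - (y + s • e + u))) = w by abel] at h1
    exact lt_of_lt_of_le ha h1
  have : (((a : ℚ) : ℝ) : EReal) ≤ genv f (y + s • e + u) := by
    classical
    have := le_iSup (fun a : ℚ => if y + s • e + u ∈ interior {y | (a : ℝ) < f y} then
      (((a : ℚ) : ℝ) : EReal) else ⊥) a
    simp only [hin, if_true] at this
    unfold genv
    convert this
  exact absurd ha1 (not_lt.2 this)

lemma genv_real (hm : DomMono f e) (x : X) : ((genvR f x : ℝ) : EReal) = genv f x := by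
  refine EReal.coe_toReal ?_ ?_
  · exact ne_of_lt (lt_of_le_of_lt (genv_le f x) (EReal.coe_lt_top _))
  · have := le_genv hm (x - (1 : ℝ) • e) 0 1 (by simp)
    rw [show x - (1 : ℝ) • e + (1 : ℝ) • e + 0 = x by module] at this
    exact ne_of_gt (lt_of_lt_of_le (EReal.bot_lt_coe _) this)

lemma genvR_le (hm : DomMono f e) (x : X) : genvR f x ≤ f x := by
  have := genv_le f x
  rw [← genv_real hm] at this
  exact_mod_cast this

lemma le_genvR (hm : DomMono f e) (y u : X) (s : ℝ) (hu : ‖u‖ < s) :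
    f y ≤ genvR f (y + s • e + u) := by
  have := le_genv hm y u s hu
  rw [← genv_real hm] at this
  exact_mod_cast this

lemma measurable_genvR [MeasurableSpace X] [BorelSpace X] (f : X → ℝ) : Measurable (genvR f) := by
  classical
  refine measurable_ereal_toReal.comp ?_
  unfold genv
  refine Measurable.iSup fun a => ?_
  exact Measurable.ite isOpen_interior.measurableSet measurable_const measurable_const

lemma measurable_Qd [MeasurableSpace X] [BorelSpace X] (hg : Measurable g) (d : X) (k : ℕ) :
    Measurable (fun x => Qd g x d k) := by
  unfold Qd
  have h1 : Measurable (fun x : X => x + (k : ℝ)⁻¹ • d) :=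
    (by fun_prop : Continuous (fun x : X => x + (k : ℝ)⁻¹ • d)).measurable
  exact ((hg.comp h1).sub hg).const_mul _

lemma measurableSet_goodPair [MeasurableSpace X] [BorelSpace X] (hg : Measurable g) (d d' : X) :
    MeasurableSet {x | GoodPair f g x d d'} := by
  have h1 : MeasurableSet {x | ContinuousAt f x} := (IsGδ.setOfPred_continuousAt f).measurableSet
  have h2 (d : X) : MeasurableSet {x | ∃ l, Tendsto (Qd g x d) atTop (𝓝 l)} :=
    measurableSet_exists_tendsto (f := fun k x => Qd g x d k) (measurable_Qd hg d)
  have h3 : MeasurableSet {x | Tendsto (fun k => Qd g x (d + d') k - Qd g x d k - Qd g x d' k)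
      atTop (𝓝 0)} :=
    measurableSet_tendsto (f := fun k x => Qd g x (d + d') k - Qd g x d k - Qd g x d' k) (𝓝 0)
      fun k => ((measurable_Qd hg _ k).sub (measurable_Qd hg _ k)).sub (measurable_Qd hg _ k)
  exact h1.inter ((h2 d).inter ((h2 d').inter h3))

lemma eq_of_cont (hgf : ∀ y, g y ≤ f y)
    (hS : ∀ y u s, ‖u‖ < s → f y ≤ g (y + s • e + u)) (hc : ContinuousAt f x) : g x = f x := by
  refine le_antisymm (hgf x) ?_
  have h1 : Tendsto (fun s : ℝ => f (x - s • e)) (𝓝[>] 0) (𝓝 (f x)) := by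
    have : Tendsto (fun s : ℝ => x - s • e) (𝓝[>] 0) (𝓝 x) := by
      have : Continuous (fun s : ℝ => x - s • e) := by fun_prop
      simpa using (this.tendsto 0).mono_left nhdsWithin_le_nhds
    exact hc.tendsto.comp this
  refine le_of_tendsto h1 ?_
  filter_upwards [self_mem_nhdsWithin] with s hs
  have := hS (x - s • e) 0 s (by simpa using hs)
  simpa using this

/-- From full derivatives of `f` along the range of `T` to good pairs. -/
lemma goodPair_of_lin {E : Type*} [AddCommGroup E] [Module ℝ E] (T : E →ₗ[ℝ] X) (Λ : E →ₗ[ℝ] ℝ)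
    (hm : DomMono f e) (hgf : ∀ y, g y ≤ f y)
    (hS : ∀ y u s, ‖u‖ < s → f y ≤ g (y + s • e + u)) (τ₀ : E) (he : T τ₀ = e)
    (hT : ∀ τ, Tendsto (Qd f x (T τ)) atTop (𝓝 (Λ τ))) (τ₁ τ₂ : E) :
    GoodPair f g x (T τ₁) (T τ₂) := by
  have hinc (τ : E) : Tendsto (fun k : ℕ => f (x + (k : ℝ)⁻¹ • T τ) - f x) atTop (𝓝 0) := by
    have h := (tendsto_inv_atTop_nhds_zero_nat (𝕜 := ℝ)).mul (hT τ)
    rw [zero_mul] at h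
    refine h.congr' ?_
    filter_upwards [eventually_gt_atTop 0] with k hk
    have : (k : ℝ) ≠ 0 := by positivity
    simp only [Qd]
    field_simp
  have hc : ContinuousAt f x := by
    refine hm.continuousAt ?_ ?_
    · intro r hr
      obtain ⟨k, hk, hk0⟩ := (((hinc τ₀).eventually_lt_const hr).and (eventually_gt_atTop 0)).exists
      refine ⟨(k : ℝ)⁻¹, by positivity, ?_⟩
      rw [he] at hk
      linarith
    · intro r hr
      obtain ⟨k, hk, hk0⟩ := (((hinc (-τ₀)).eventually_const_lt (neg_lt_zero.2 hr)).and
        (eventually_gt_atTop 0)).exists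
      refine ⟨(k : ℝ)⁻¹, by positivity, ?_⟩
      rw [map_neg, he, smul_neg, ← sub_eq_add_neg] at hk
      linarith
  have hx : g x = f x := eq_of_cont hgf hS hc
  have hlim (τ : E) : Tendsto (Qd g x (T τ)) atTop (𝓝 (Λ τ)) := by
    rw [tendsto_order]
    constructor
    · intro c hcl
      obtain ⟨ε, hε, hεc⟩ : ∃ ε > 0, c < Λ τ - ε * Λ τ₀ := by
        have : Tendsto (fun ε : ℝ => Λ τ - ε * Λ τ₀) (𝓝[>] 0) (𝓝 (Λ τ)) := by
          have : Continuous (fun ε : ℝ => Λ τ - ε * Λ τ₀) := by fun_prop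
          simpa using (this.tendsto 0).mono_left nhdsWithin_le_nhds
        obtain ⟨ε, h1, h2⟩ := ((this.eventually_const_lt hcl).and self_mem_nhdsWithin).exists
        exact ⟨ε, h2, h1⟩
      have h1 := hT (τ - ε • τ₀)
      rw [map_sub, map_sub, map_smul, map_smul, he, smul_eq_mul] at h1
      filter_upwards [h1.eventually_const_lt hεc, eventually_gt_atTop 0] with k hk hk0
      refine hk.trans_le ?_
      have hk' : (0 : ℝ) < (k : ℝ)⁻¹ := by positivity
      have h2 := hS (x + (k : ℝ)⁻¹ • (T τ - ε • e)) 0 ((k : ℝ)⁻¹ * ε) (by simp; positivity)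
      rw [show x + (k : ℝ)⁻¹ • (T τ - ε • e) + ((k : ℝ)⁻¹ * ε) • e + 0
        = x + (k : ℝ)⁻¹ • T τ by module] at h2
      unfold Qd
      rw [hx]
      gcongr
    · intro c hcl
      filter_upwards [(hT τ).eventually_lt_const hcl] with k hk
      refine lt_of_le_of_lt ?_ hk
      unfold Qd
      rw [hx]
      gcongr
      exact hgf _
  refine ⟨hc, ⟨_, hlim τ₁⟩, ⟨_, hlim τ₂⟩, ?_⟩
  have := ((hlim (τ₁ + τ₂)).sub (hlim τ₁)).sub (hlim τ₂)
  rw [map_add, map_add] at this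
  simpa using this

lemma goodPair_of_hadamard (hm : DomMono f e) (hgf : ∀ y, g y ≤ f y)
    (hS : ∀ y u s, ‖u‖ < s → f y ≤ g (y + s • e + u)) (h : HadamardDiffAt f x) (d d' : X) :
    GoodPair f g x d d' := by
  obtain ⟨L, hL⟩ := h
  refine goodPair_of_lin (E := X) LinearMap.id (L : X →ₗ[ℝ] ℝ) hm hgf hS e rfl ?_ d d'
  intro τ
  rw [← tendsto_add_atTop_iff_nat 1]
  have := hL τ (fun n => ((n + 1 : ℕ) : ℝ)⁻¹) (fun n => by positivity)
    ((tendsto_add_atTop_iff_nat 1).2 (tendsto_inv_atTop_nhds_zero_nat (𝕜 := ℝ)))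
    (fun _ => τ) tendsto_const_nhds
  refine this.congr fun n => ?_
  simp only [Qd, div_inv_eq_mul, LinearMap.id_coe, id]
  ring

/-- extension of a bounded additive map from a dense subgroup -/
lemma exists_extend (D : AddSubgroup X) (hD : Dense (D : Set X)) (q : D →+ ℝ) (C : ℝ)
    (hC : ∀ d : D, |q d| ≤ C * ‖(d : X)‖) : ∃ L : X →L[ℝ] ℝ, ∀ d : D, L d = q d := by
  have hcont : Continuous q := AddMonoidHomClass.continuous_of_bound q C hC
  let q' : D →L[ℤ] ℝ := ⟨q.toIntLinearMap, hcont⟩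
  let i : D →L[ℤ] X := ⟨D.subtype.toIntLinearMap, continuous_subtype_val⟩
  have hi : DenseRange i := by
    have : range i = (D : Set X) := Subtype.range_coe
    rw [DenseRange, this]; exact hD
  have hu : IsUniformInducing i := isUniformEmbedding_subtype_val.isUniformInducing
  let L := q'.extend i
  refine ⟨AddMonoidHom.toRealLinearMap (L : X →+ ℝ) L.continuous, fun d => ?_⟩
  exact q'.extend_eq hi hu d

lemma hadamard_of_good (D : AddSubgroup X) (hD : Dense (D : Set X)) (he : e ∈ D)
    (hgf : ∀ y, g y ≤ f y)
    (hS : ∀ y u s, ‖u‖ < s → f y ≤ g (y + s • e + u))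
    (hgood : ∀ d ∈ D, ∀ d' ∈ D, GoodPair f g x d d') : HadamardDiffAt f x := by
  have hc : ContinuousAt f x := (hgood e he e he).1
  have hx : g x = f x := eq_of_cont hgf hS hc
  have hgg : ∀ y u s, ‖u‖ < s → g y ≤ g (y + s • e + u) := fun y u s h =>
    (hgf y).trans (hS y u s h)
  have hex : ∀ d : D, ∃ l, Tendsto (Qd g x d) atTop (𝓝 l) := fun d => (hgood d d.2 e he).2.1
  choose q hq using hex
  have qadd : ∀ d d' : D, q (d + d') = q d + q d' := by
    intro d d'
    have h1 := ((hq (d + d')).sub (hq d)).sub (hq d')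
    have h2 := (hgood d d.2 d' d'.2).2.2.2
    have := tendsto_nhds_unique h1 h2
    linarith
  let qh : D →+ ℝ := AddMonoidHom.mk' q qadd
  have hqh : ∀ d, qh d = q d := fun d => rfl
  let e' : D := ⟨e, he⟩
  have hmn : ∀ (d : D) (m p : ℕ), m * ‖(d : X)‖ < p → m * q d ≤ p * q e' := by
    intro d m p hmp
    have h1 : q (m • d) ≤ q (p • e') := by
      refine le_of_tendsto_of_tendsto (hq (m • d)) (hq (p • e')) ?_
      filter_upwards [eventually_gt_atTop 0] with k hk
      have hk' : (0 : ℝ) < (k : ℝ)⁻¹ := by positivity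
      have h2 := hgg (x + (k : ℝ)⁻¹ • ((m • d : D) : X)) (-((k : ℝ)⁻¹ • ((m • d : D) : X)))
        ((k : ℝ)⁻¹ * p) (by
          rw [norm_neg, norm_smul, Real.norm_eq_abs, abs_of_pos hk']
          refine mul_lt_mul_of_pos_left (lt_of_le_of_lt ?_ hmp) hk'
          have h3 : ((m • d : D) : X) = m • (d : X) := rfl
          rw [h3]
          exact norm_nsmul_le)
      have h4 : ((p • e' : D) : X) = (p : ℝ) • e := by
        rw [Nat.cast_smul_eq_nsmul]; rfl
      rw [show x + (k : ℝ)⁻¹ • ((m • d : D) : X) + ((k : ℝ)⁻¹ * p) • e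
        + -((k : ℝ)⁻¹ • ((m • d : D) : X)) = x + (k : ℝ)⁻¹ • ((p • e' : D) : X) by
          rw [h4]; module] at h2
      simp only [Qd]
      gcongr
    rw [← hqh, ← hqh, map_nsmul, map_nsmul, nsmul_eq_mul, nsmul_eq_mul] at h1
    exact h1
  have he0 : 0 ≤ q e' := by
    have := hmn 0 0 1 (by simp)
    simpa using this
  have hub : ∀ d : D, q d ≤ q e' * ‖(d : X)‖ := by
    intro d
    by_contra hcon
    push Not at hcon
    obtain ⟨m, hm⟩ := exists_nat_gt (q e' / (q d - q e' * ‖(d : X)‖))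
    rw [div_lt_iff₀ (by linarith)] at hm
    have h1 := hmn d m (⌊m * ‖(d : X)‖⌋₊ + 1) (by push_cast; exact Nat.lt_floor_add_one _)
    have h2 : ((⌊m * ‖(d : X)‖⌋₊ + 1 : ℕ) : ℝ) ≤ m * ‖(d : X)‖ + 1 := by
      push_cast
      have := Nat.floor_le (show 0 ≤ m * ‖(d : X)‖ by positivity)
      linarith
    have h3 := mul_le_mul_of_nonneg_right h2 he0
    linarith
  obtain ⟨L, hL⟩ := exists_extend D hD qh (q e') (by
    intro d
    rw [abs_le]
    refine ⟨?_, hub d⟩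
    have h1 := hub (-d)
    have h2 : q (-d) = - q d := by rw [← hqh, ← hqh, map_neg]
    rw [h2] at h1
    simp only [NegMemClass.coe_neg, norm_neg] at h1
    rw [hqh]; linarith)
  have hLq : ∀ d : D, L d = q d := hL
  have hfil : ∀ (l : Filter ℕ) (h : X) (t : ℕ → ℝ), Tendsto t l (𝓝[>] 0) →
      ∀ hs : ℕ → X, Tendsto hs l (𝓝 h) →
      Tendsto (fun n => (f (x + t n • hs n) - f x) / t n) l (𝓝 (L h)) := by
    intro l h t ht hs hhs
    have htpos : ∀ᶠ n in l, 0 < t n := ht.eventually self_mem_nhdsWithin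
    have hinv : Tendsto (fun n => (t n)⁻¹) l atTop := tendsto_inv_nhdsGT_zero.comp ht
    set k : ℕ → ℕ := fun n => ⌊(t n)⁻¹⌋₊ with hk
    have hkt : Tendsto k l atTop := tendsto_nat_floor_atTop.comp hinv
    have hk1 : Tendsto (fun n => (k n : ℝ) * t n) l (𝓝 1) := by
      have := (tendsto_nat_floor_div_atTop (R := ℝ)).comp hinv
      refine this.congr fun n => ?_
      simp [hk, Function.comp, div_inv_eq_mul]
    have hkpos : ∀ᶠ n in l, 0 < k n := hkt.eventually (eventually_gt_atTop 0)
    have hkh : Tendsto (fun n => ((k n : ℝ) * t n) • hs n) l (𝓝 h) := by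
      simpa using hk1.smul hhs
    have hquot (d : D) : Tendsto (fun n => Qd g x d (k n) / ((k n : ℝ) * t n)) l (𝓝 (L d)) := by
      have := ((hq d).comp hkt).div hk1 one_ne_zero
      rw [div_one, ← hLq] at this
      exact this
    -- choice of nearby directions
    have hnear : ∀ (σ : ℝ) (U : Set ℝ), IsOpen U → L h ∈ U → ∃ η > 0, ∃ d : D, L d ∈ U ∧
        ‖(d : X) - (h + (σ * (2 * η)) • e)‖ < η := by
      intro σ U hU hLU
      have h1 : Tendsto (fun η : ℝ => L (h + (σ * (2 * η)) • e)) (𝓝[>] 0) (𝓝 (L h)) := by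
        have : Continuous (fun η : ℝ => L (h + (σ * (2 * η)) • e)) := by fun_prop
        simpa using (this.tendsto 0).mono_left nhdsWithin_le_nhds
      obtain ⟨η, hη1, hη⟩ := ((h1.eventually (hU.mem_nhds hLU)).and self_mem_nhdsWithin).exists
      have h2 : IsOpen (L ⁻¹' U ∩ Metric.ball (h + (σ * (2 * η)) • e) η) :=
        (hU.preimage L.continuous).inter Metric.isOpen_ball
      obtain ⟨d, hd, hdD⟩ := hD.inter_open_nonempty _ h2 ⟨_, hη1, Metric.mem_ball_self hη⟩
      refine ⟨η, hη, ⟨d, hdD⟩, hd.1, ?_⟩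
      have := hd.2
      rwa [Metric.mem_ball, dist_eq_norm] at this
    rw [tendsto_order]
    constructor
    · intro c hc
      obtain ⟨η, hη, d, hd, hdn⟩ := hnear (-1) (Ioi c) isOpen_Ioi hc
      have hev : ∀ᶠ n in l, ‖((k n : ℝ) * t n) • hs n - h‖ < η := by
        have := hkh.eventually (Metric.ball_mem_nhds h hη)
        simpa [dist_eq_norm] using this
      filter_upwards [(hquot d).eventually_const_lt hd, hev, htpos, hkpos] with n h1 h2 h3 h4
      refine h1.trans_le ?_
      have hkp : (0 : ℝ) < k n := by exact_mod_cast h4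
      have h5 := hS (x + (k n : ℝ)⁻¹ • (d : X))
        ((k n : ℝ)⁻¹ • ((((k n : ℝ) * t n) • hs n - h) - ((d : X) - (h + (-1 * (2 * η)) • e))))
        ((k n : ℝ)⁻¹ * (2 * η)) (by
          rw [norm_smul, Real.norm_eq_abs, abs_of_pos (inv_pos.2 hkp)]
          refine mul_lt_mul_of_pos_left ((norm_sub_le _ _).trans_lt ?_) (inv_pos.2 hkp)
          linarith)
      have h6 : x + (k n : ℝ)⁻¹ • (d : X) + ((k n : ℝ)⁻¹ * (2 * η)) • e +
        ((k n : ℝ)⁻¹ • ((((k n : ℝ) * t n) • hs n - h) - ((d : X) - (h + (-1 * (2 * η)) • e))))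
        = x + t n • hs n := by
        have : t n • hs n = (k n : ℝ)⁻¹ • (((k n : ℝ) * t n) • hs n) := by
          rw [smul_smul, ← mul_assoc, inv_mul_cancel₀ hkp.ne', one_mul]
        rw [this]; module
      rw [h6] at h5
      have h7 := (hgf _).trans (h5.trans (hgf _))
      simp only [Qd]
      rw [mul_div_mul_left _ _ hkp.ne', hx]
      gcongr
    · intro c hc
      obtain ⟨η, hη, d, hd, hdn⟩ := hnear 1 (Iio c) isOpen_Iio hc
      have hev : ∀ᶠ n in l, ‖((k n : ℝ) * t n) • hs n - h‖ < η := by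
        have := hkh.eventually (Metric.ball_mem_nhds h hη)
        simpa [dist_eq_norm] using this
      filter_upwards [(hquot d).eventually_lt_const hd, hev, htpos, hkpos] with n h1 h2 h3 h4
      refine lt_of_le_of_lt ?_ h1
      have hkp : (0 : ℝ) < k n := by exact_mod_cast h4
      have h5 := hS (x + t n • hs n)
        ((k n : ℝ)⁻¹ • (((d : X) - (h + (1 * (2 * η)) • e)) - (((k n : ℝ) * t n) • hs n - h)))
        ((k n : ℝ)⁻¹ * (2 * η)) (by
          rw [norm_smul, Real.norm_eq_abs, abs_of_pos (inv_pos.2 hkp)]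
          refine mul_lt_mul_of_pos_left ((norm_sub_le _ _).trans_lt ?_) (inv_pos.2 hkp)
          linarith)
      have h6 : x + t n • hs n + ((k n : ℝ)⁻¹ * (2 * η)) • e +
        ((k n : ℝ)⁻¹ • (((d : X) - (h + (1 * (2 * η)) • e)) - (((k n : ℝ) * t n) • hs n - h)))
        = x + (k n : ℝ)⁻¹ • (d : X) := by
        have : t n • hs n = (k n : ℝ)⁻¹ • (((k n : ℝ) * t n) • hs n) := by
          rw [smul_smul, ← mul_assoc, inv_mul_cancel₀ hkp.ne', one_mul]
        rw [this]; module
      rw [h6] at h5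
      simp only [Qd]
      rw [mul_div_mul_left _ _ hkp.ne', hx]
      gcongr
  refine ⟨L, fun h t ht0 ht hs hhs => ?_⟩
  have hp : Tendsto (fun n => (f (x + t n • hs n) - f x) / t n)
      (atTop ⊓ 𝓟 {n | 0 < t n}) (𝓝 (L h)) := by
    refine hfil _ h t ?_ hs (hhs.mono_left inf_le_left)
    refine tendsto_nhdsWithin_iff.2 ⟨ht.mono_left inf_le_left, ?_⟩
    exact mem_inf_of_right (mem_principal_self _)
  have hn : Tendsto (fun n => (f (x + t n • hs n) - f x) / t n)
      (atTop ⊓ 𝓟 {n | 0 < t n}ᶜ) (𝓝 (L h)) := by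
    have h1 := hfil (atTop ⊓ 𝓟 {n | 0 < t n}ᶜ) (-h) (fun n => - t n) (by
      refine tendsto_nhdsWithin_iff.2 ⟨by simpa using ht.neg.mono_left inf_le_left, ?_⟩
      refine mem_inf_of_right (mem_principal.2 fun n hn => ?_)
      have h2 : ¬ 0 < t n := hn
      have h3 : t n < 0 := lt_of_le_of_ne (not_lt.1 h2) (ht0 n)
      simpa using h3) (fun n => - hs n) (hhs.neg.mono_left inf_le_left)
    have h2 := h1.neg
    rw [map_neg, neg_neg] at h2
    refine h2.congr fun n => ?_
    rw [smul_neg, neg_smul, neg_neg, div_neg, neg_neg]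
  have := hp.sup hn
  rwa [← inf_sup_left, sup_principal, union_compl_self, principal_univ, inf_top_eq] at this
end had

section asm
variable {X : Type*} [NormedAddCommGroup X] [NormedSpace ℝ X]

lemma exists_domMono {K : Set X} (hK : IsClosedConvexCone K) {f : X → ℝ}
    (hf : ∀ u, ∀ k ∈ K, f u ≤ f (u + k)) {e₀ : X} (he : e₀ ∈ interior K) :
    ∃ c : ℕ, DomMono f (c • e₀) := by
  obtain ⟨ρ, hρ, hball⟩ := Metric.mem_nhds_iff.1 (mem_interior_iff_mem_nhds.1 he)
  obtain ⟨c, hc⟩ := exists_nat_gt ρ⁻¹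
  have hc0 : (0 : ℝ) < c := (inv_pos.2 hρ).trans hc
  refine ⟨c, fun x y s hy => ?_⟩
  have hmem : s • (c • e₀) + y ∈ K := by
    rcases eq_or_lt_of_le ((norm_nonneg y).trans hy) with hs | hs
    · have hy0 : y = 0 := by
        rw [← hs] at hy
        exact norm_le_zero_iff.1 hy
      rw [← hs, hy0]
      have := hK.2.2 0 le_rfl e₀ (interior_subset he)
      simpa using this
    · have h1 : e₀ + (s * c)⁻¹ • y ∈ K := by
        apply hball
        rw [Metric.mem_ball, dist_eq_norm, add_sub_cancel_left, norm_smul, Real.norm_eq_abs,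
          abs_of_pos (by positivity)]
        rw [inv_mul_lt_iff₀ (by positivity)]
        have h2 : 1 < c * ρ := by
          rwa [inv_lt_iff_one_lt_mul₀ hρ] at hc
        calc ‖y‖ ≤ s * 1 := by simpa using hy
          _ < s * (c * ρ) := mul_lt_mul_of_pos_left h2 hs
          _ = s * c * ρ := by ring
      have h3 := hK.2.2 (s * c) (by positivity) _ h1
      rw [smul_add, smul_smul, mul_inv_cancel₀ (by positivity), one_smul, mul_smul,
        Nat.cast_smul_eq_nsmul] at h3
      exact h3
  have := hf x _ hmem
  rwa [← add_assoc] at this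

/-- rational combinations -/
noncomputable def ratComb (ξ : ℕ → X) : (ℕ →₀ ℚ) →+ X :=
  Finsupp.liftAddHom (fun i =>
    ((smulAddHom ℝ X).flip (ξ i)).comp (Rat.castHom ℝ).toAddMonoidHom)

lemma ratComb_apply (ξ : ℕ → X) (c : ℕ →₀ ℚ) :
    ratComb ξ c = c.sum fun i q => (q : ℝ) • ξ i := rfl

lemma ratComb_eq (ξ : ℕ → X) (c : ℕ →₀ ℚ) (n : ℕ) (hn : c.support ⊆ Finset.range n) :
    ∑ i : Fin n, (c i : ℝ) • ξ i = ratComb ξ c := by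
  rw [ratComb_apply, Finsupp.sum_of_support_subset c hn _ (by simp),
    Finset.sum_range]

lemma dense_ratComb (ξ : ℕ → X) (hξ : Dense (Submodule.span ℝ (Set.range ξ) : Set X)) :
    Dense ((ratComb ξ).range : Set X) := by
  have hsub : (Submodule.span ℝ (Set.range ξ) : Set X) ⊆ closure ((ratComb ξ).range : Set X) := by
    intro y hy
    induction hy using Submodule.span_induction with
    | mem y hy =>
      obtain ⟨i, rfl⟩ := hy
      refine subset_closure ⟨Finsupp.single i 1, ?_⟩
      simp [ratComb_apply]
    | zero => exact subset_closure (zero_mem _)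
    | add a b _ _ ha hb =>
      exact map_mem_closure₂ continuous_add ha hb fun a ha b hb => add_mem ha hb
    | smul r a _ ha =>
      refine map_mem_closure₂ (f := fun (r : ℝ) (a : X) => r • a) (s := range ((↑) : ℚ → ℝ))
        continuous_smul (Rat.denseRange_cast r) ha ?_
      rintro _ ⟨q, rfl⟩ _ ⟨c, rfl⟩
      refine ⟨q • c, ?_⟩
      rw [ratComb_apply, ratComb_apply, Finsupp.sum_smul_index (by simp), Finsupp.smul_sum]
      simp [mul_smul]
  intro y
  have := closure_mono hsub (hξ y)
  rwa [closure_closure] at this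

variable [TopologicalSpace.SeparableSpace X] [MeasurableSpace X] [BorelSpace X]

lemma slice_decomp {f : X → ℝ} {B : ℝ} (hB : ∀ x, |f x| ≤ B) (ξ : ℕ → X) (c₀ : ℕ →₀ ℚ)
    (hm : DomMono f (ratComb ξ c₀)) (c c' : ℕ →₀ ℚ) :
    Decomp ξ {x | ¬ GoodPair f (genvR f) x (ratComb ξ c) (ratComb ξ c')} := by
  obtain ⟨n, hn⟩ := Finset.exists_nat_subset_range (c₀.support ∪ (c.support ∪ c'.support))
  have hn0 : c₀.support ⊆ Finset.range n := Finset.subset_union_left.trans hn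
  have hn1 : c.support ⊆ Finset.range n :=
    (Finset.subset_union_left.trans Finset.subset_union_right).trans hn
  have hn2 : c'.support ⊆ Finset.range n :=
    (Finset.subset_union_right.trans Finset.subset_union_right).trans hn
  refine decomp_of_null ξ n _ (measurableSet_goodPair (measurable_genvR f) _ _).compl fun x => ?_
  let T : (Fin n → ℝ) →L[ℝ] X := ∑ i : Fin n, (ContinuousLinearMap.proj i).smulRight (ξ i)
  have hTapp : ∀ t, T t = ∑ i, t i • ξ i := by
    intro t
    simp [T, ContinuousLinearMap.sum_apply]
  set e := ratComb ξ c₀ with he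
  have hTc : ∀ c : ℕ →₀ ℚ, c.support ⊆ Finset.range n →
      T (fun i => (c i : ℝ)) = ratComb ξ c := by
    intro c hc
    rw [hTapp, ratComb_eq ξ c n hc]
  let F : (Fin n → ℝ) → ℝ := fun t => f (x + T t)
  have hFm : DomMono F ((‖T‖ + 1) • (fun i : Fin n => (c₀ i : ℝ))) := by
    intro t y s hy
    have hs : 0 ≤ s := (norm_nonneg y).trans hy
    have h1 := hm (x + T t) (T y) (s * (‖T‖ + 1)) (by
      refine (T.le_opNorm y).trans ?_
      nlinarith [norm_nonneg T, norm_nonneg y, mul_le_mul_of_nonneg_left hy (norm_nonneg T)])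
    simp only [F, map_add, map_smul]
    rw [hTc c₀ hn0, smul_smul, ← add_assoc, ← add_assoc]
    exact h1
  have hae := fin_ae_diff hFm (B := B) (fun t => hB _)
  refine measure_mono_null ?_ (ae_iff.1 hae)
  intro t ht hdiff
  refine ht ?_
  rw [← hTapp, ← hTc c hn1, ← hTc c' hn2]
  refine goodPair_of_lin (T : (Fin n → ℝ) →ₗ[ℝ] X) (fderiv ℝ F t : (Fin n → ℝ) →ₗ[ℝ] ℝ) hm
    (genvR_le hm) (le_genvR hm) (fun i => (c₀ i : ℝ)) (hTc c₀ hn0) ?_ _ _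
  intro τ
  have hlim := hdiff.hasFDerivAt.lim τ (c := fun k : ℕ => (k : ℝ)) (l := atTop) (by
    simpa using tendsto_natCast_atTop_atTop (R := ℝ))
  refine hlim.congr fun k => ?_
  simp only [Qd, F, smul_eq_mul, map_add, map_smul, ContinuousLinearMap.coe_coe, add_assoc]

lemma exists_ratComb {K : Set X} (hK : IsClosedConvexCone K) (hKint : (interior K).Nonempty)
    {f : X → ℝ} (hf : ∀ u, ∀ k ∈ K, f u ≤ f (u + k))
    (ξ : ℕ → X) (hξ : Dense (Submodule.span ℝ (Set.range ξ) : Set X)) :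
    ∃ c₀, DomMono f (ratComb ξ c₀) := by
  obtain ⟨_, he, ⟨c, rfl⟩⟩ := (dense_ratComb ξ hξ).inter_open_nonempty _ isOpen_interior hKint
  obtain ⟨m, hm⟩ := exists_domMono hK hf he
  exact ⟨m • c, by rwa [map_nsmul]⟩

lemma global_case {K : Set X} (hK : IsClosedConvexCone K) (hKint : (interior K).Nonempty)
    {f : X → ℝ} {B : ℝ} (hB : ∀ x, |f x| ≤ B) (hf : ∀ u, ∀ k ∈ K, f u ≤ f (u + k)) :
    ∃ N : Set X, AronszajnNull N ∧ ∀ x, x ∉ N → HadamardDiffAt f x := by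
  have hne : Nonempty X := ⟨0⟩
  let ζ := TopologicalSpace.denseSeq X
  have hζ : Dense (Submodule.span ℝ (Set.range ζ) : Set X) :=
    (TopologicalSpace.denseRange_denseSeq X).mono Submodule.subset_span
  obtain ⟨b₀, hb₀⟩ := exists_ratComb hK hKint hf ζ hζ
  let N : Set X := ⋃ p : (ℕ →₀ ℚ) × (ℕ →₀ ℚ),
    {x | ¬ GoodPair f (genvR f) x (ratComb ζ p.1) (ratComb ζ p.2)}
  have hNm : MeasurableSet N := MeasurableSet.iUnion fun p =>
    (measurableSet_goodPair (measurable_genvR f) _ _).compl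
  have key : ∀ (ξ : ℕ → X) (_ : Dense (Submodule.span ℝ (Set.range ξ) : Set X)) (x : X),
      (∀ c c', GoodPair f (genvR f) x (ratComb ξ c) (ratComb ξ c')) → HadamardDiffAt f x := by
    intro ξ hξ x hx
    obtain ⟨c₀, hc₀⟩ := exists_ratComb hK hKint hf ξ hξ
    refine hadamard_of_good (ratComb ξ).range (dense_ratComb ξ hξ) ⟨c₀, rfl⟩
      (genvR_le hc₀) (le_genvR hc₀) ?_
    rintro _ ⟨c, rfl⟩ _ ⟨c', rfl⟩
    exact hx c c'
  refine ⟨N, ⟨hNm, fun ξ hξ => ?_⟩, fun x hx => ?_⟩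
  · obtain ⟨c₀, hc₀⟩ := exists_ratComb hK hKint hf ξ hξ
    have hdec := Decomp.iUnion (ι := (ℕ →₀ ℚ) × (ℕ →₀ ℚ))
      (fun p => slice_decomp hB ξ c₀ hc₀ p.1 p.2)
    refine hdec.mono hNm ?_
    intro x hx
    by_contra hcon
    simp only [mem_iUnion, mem_setOf_eq, not_exists, not_not] at hcon
    have hH := key ξ hξ x fun c c' => hcon (c, c')
    obtain ⟨p, hp⟩ := mem_iUnion.1 hx
    exact hp (goodPair_of_hadamard hb₀ (genvR_le hb₀) (le_genvR hb₀) hH _ _)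
  · simp only [N, mem_iUnion, mem_setOf_eq, not_exists, not_not] at hx
    exact key ζ hζ x fun c c' => hx (c, c')
end asm

/-- **Borwein–Wang.** On a separable Banach space, a `K`-nondecreasing function on a
nonempty open set `V` is Hadamard differentiable on `V` off an Aronszajn null set. -/
theorem stmt_0 {X : Type*} [NormedAddCommGroup X] [NormedSpace ℝ X] [CompleteSpace X]
    [TopologicalSpace.SeparableSpace X] [MeasurableSpace X] [BorelSpace X]
    (K V : Set X) (hK : IsClosedConvexCone K) (hKint : (interior K).Nonempty)
    (hVopen : IsOpen V) (hVne : V.Nonempty)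
    (f : X → ℝ) (hf : KNondecreasingOn f K V) :
    ∃ N : Set X, AronszajnNull N ∧ ∀ x ∈ V \ N, HadamardDiffWithinAt f V x := by
  have h0K : (0 : X) ∈ K := by
    obtain ⟨k, hk⟩ := hKint
    simpa using hK.2.2 0 le_rfl k (interior_subset hk)
  have haddK : ∀ a ∈ K, ∀ b ∈ K, a + b ∈ K := by
    intro a ha b hb
    have h1 := hK.2.1 ha hb (show (0 : ℝ) ≤ 1 / 2 by norm_num) (show (0 : ℝ) ≤ 1 / 2 by norm_num)
      (by norm_num)
    have h2 := hK.2.2 2 (by norm_num) _ h1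
    rw [show (2 : ℝ) • ((1 / 2 : ℝ) • a + (1 / 2 : ℝ) • b) = a + b by module] at h2
    exact h2
  -- bounded globally monotone extension of `arctan ∘ f`
  let S : X → Set ℝ := fun x => insert (-2) ((fun y => Real.arctan (f y)) '' {y ∈ V | x - y ∈ K})
  let F : X → ℝ := fun x => sSup (S x)
  have hatan : ∀ r, |Real.arctan r| ≤ 2 := by
    intro r
    have h1 := Real.arctan_lt_pi_div_two r
    have h2 := Real.neg_pi_div_two_lt_arctan r
    have h3 := Real.pi_lt_four
    rw [abs_le]; constructor <;> linarith
  have hSle : ∀ x, ∀ s ∈ S x, s ≤ 2 := by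
    rintro x s (rfl | ⟨y, _, rfl⟩)
    · norm_num
    · exact (abs_le.1 (hatan _)).2
  have hSbdd : ∀ x, BddAbove (S x) := fun x => ⟨2, hSle x⟩
  have hSne : ∀ x, (S x).Nonempty := fun x => ⟨-2, mem_insert _ _⟩
  have hFB : ∀ x, |F x| ≤ 2 := fun x =>
    abs_le.2 ⟨le_csSup (hSbdd x) (mem_insert _ _), csSup_le (hSne x) (hSle x)⟩
  have hFm : ∀ u, ∀ k ∈ K, F u ≤ F (u + k) := by
    intro u k hk
    refine csSup_le_csSup (hSbdd _) (hSne _) ?_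
    refine insert_subset_insert (image_mono fun y hy => ⟨hy.1, ?_⟩)
    rw [show u + k - y = (u - y) + k by abel]
    exact haddK _ hy.2 _ hk
  have hFf : ∀ x ∈ V, F x = Real.arctan (f x) := by
    intro x hx
    apply le_antisymm
    · refine csSup_le (hSne x) ?_
      rintro s (rfl | ⟨y, ⟨hyV, hyK⟩, rfl⟩)
      · exact (abs_le.1 (hatan _)).1
      · refine Real.arctan_strictMono.monotone ?_
        by_cases hxy : x - y = 0
        · rw [sub_eq_zero.1 hxy]
        · have := hf y hyV (x - y) hyK hxy (by simpa using hx)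
          simpa using this
    · exact le_csSup (hSbdd x) (mem_insert_of_mem _ ⟨x, ⟨hx, by simpa using h0K⟩, rfl⟩)
  obtain ⟨N, hN, hd⟩ := global_case hK hKint hFB hFm
  refine ⟨N, hN, fun x hx => ?_⟩
  obtain ⟨L, hL⟩ := hd x hx.2
  set a := Real.arctan (f x) with ha
  have hcos : Real.cos a ≠ 0 := (Real.cos_arctan_pos _).ne'
  have htan : HasDerivAt Real.tan (1 / Real.cos a ^ 2) a := Real.hasDerivAt_tan hcos
  refine ⟨(1 / Real.cos a ^ 2) • L, fun h t ht0 ht hs hhs hV => ?_⟩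
  have h1 := hL h t ht0 ht hs hhs
  have h2 : Tendsto (fun n => F (x + t n • hs n)) atTop (𝓝 a) := by
    have h3 := (h1.mul ht).add_const (F x)
    rw [mul_zero, zero_add, hFf x hx.1] at h3
    refine h3.congr fun n => ?_
    rw [div_mul_cancel₀ _ (ht0 n), sub_add_cancel]
  have h4 : Tendsto (dslope Real.tan a) (𝓝 a) (𝓝 (1 / Real.cos a ^ 2)) := by
    have := (continuousAt_dslope_same.2 htan.differentiableAt).tendsto
    rwa [dslope_same, htan.deriv] at this
  have h5 := (h4.comp h2).mul h1
  refine h5.congr fun n => ?_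
  have h6 := sub_smul_dslope Real.tan a (F (x + t n • hs n))
  rw [smul_eq_mul, hFf _ (hV n), ha, Real.tan_arctan, Real.tan_arctan] at h6
  rw [← h6]
  simp only [Function.comp, hFf _ (hV n), hFf x hx.1]
  ring
end

section
/- Let X be a reflexive separable real Banach space and let f : X → ℝ be quasiconvex. Then f is densely continuous if and only if the set of points at which f is not continuous is Haar null. -/
open Filter Topology Set MeasureTheory

section Geometry

variable {X : Type*} [NormedAddCommGroup X] [NormedSpace ℝ X]

lemma conv_add_aux {C : Set X} (hC : Convex ℝ C) {m n : ℝ} (hm : 0 < m) (hn : 0 < n)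
    {a b : X} (ha : a ∈ C) (hb : b ∈ C) : ∃ c ∈ C, m • a + n • b = (m + n) • c := by
  have hmn : 0 < m + n := by linarith
  refine ⟨(m / (m + n)) • a + (n / (m + n)) • b,
    hC ha hb (by positivity) (by positivity) (by field_simp), ?_⟩
  rw [smul_add, smul_smul, smul_smul, mul_div_cancel₀ _ hmn.ne', mul_div_cancel₀ _ hmn.ne']

lemma span_aux {C : Set X} (hC : Convex ℝ C) (h0 : (0 : X) ∈ C) {x : X}
    (hx : x ∈ Submodule.span ℝ C) : ∃ m : ℝ, 0 < m ∧ ∃ a ∈ C, ∃ b ∈ C, x = m • a - m • b := by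
  induction hx using Submodule.span_induction with
  | mem x h => exact ⟨1, one_pos, x, h, 0, h0, by simp⟩
  | zero => exact ⟨1, one_pos, 0, h0, 0, h0, by simp⟩
  | add x y _ _ hx hy =>
    obtain ⟨m, hm, a, ha, b, hb, rfl⟩ := hx
    obtain ⟨n, hn, a', ha', b', hb', rfl⟩ := hy
    obtain ⟨c, hc, h1⟩ := conv_add_aux hC hm hn ha ha'
    obtain ⟨d, hd, h2⟩ := conv_add_aux hC hm hn hb hb'
    refine ⟨m + n, by linarith, c, hc, d, hd, ?_⟩
    rw [← h1, ← h2]; abel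
  | smul r x _ hx =>
    obtain ⟨m, hm, a, ha, b, hb, rfl⟩ := hx
    rcases lt_trichotomy r 0 with hr | hr | hr
    · refine ⟨-r * m, by nlinarith, b, hb, a, ha, ?_⟩
      module
    · exact ⟨1, one_pos, 0, h0, 0, h0, by simp [hr]⟩
    · refine ⟨r * m, by positivity, a, ha, b, hb, ?_⟩
      module

lemma finite_aux {C : Set X} (hC : Convex ℝ C) (h0 : (0 : X) ∈ C)
    (hs : Submodule.span ℝ C = ⊤) (F : Finset X) :
    ∃ m : ℝ, 0 < m ∧ ∃ p : X, (∃ c ∈ C, p = m • c) ∧ ∀ d ∈ F, ∃ c ∈ C, d + p = m • c := by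
  classical
  induction F using Finset.induction_on with
  | empty => exact ⟨1, one_pos, 0, ⟨0, h0, by simp⟩, by simp⟩
  | insert d0 F _ ih =>
    obtain ⟨m, hm, p, ⟨c0, hc0, hp⟩, hF⟩ := ih
    obtain ⟨n, hn, a, ha, b, hb, hd⟩ := span_aux hC h0 (x := d0) (by rw [hs]; trivial)
    refine ⟨m + n, by linarith, p + n • b, ?_, ?_⟩
    · obtain ⟨c, hc, h⟩ := conv_add_aux hC hm hn hc0 hb
      exact ⟨c, hc, by rw [← h, hp]⟩
    · intro d hdF
      rcases Finset.mem_insert.1 hdF with rfl | hdF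
      · obtain ⟨c, hc, h⟩ := conv_add_aux hC hm hn hc0 ha
        exact ⟨c, hc, by rw [← h, hp, hd]; abel⟩
      · obtain ⟨c1, hc1, h1⟩ := hF d hdF
        obtain ⟨c, hc, h⟩ := conv_add_aux hC hm hn hc1 hb
        exact ⟨c, hc, by rw [← h, ← h1]; abel⟩

/-- Cancellation: if the ball of radius `ε` is within `ε/2` of a closed convex set `G`,
then `G` contains the ball of radius `ε/2`. -/
lemma cancel_aux {G : Set X} (hG : Convex ℝ G) (hcl : IsClosed G) {ε : ℝ} (hε : 0 < ε)
    (h : ∀ y : X, ‖y‖ ≤ ε → ∃ g ∈ G, ‖y - g‖ ≤ ε / 2) :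
    Metric.closedBall (0 : X) (ε / 2) ⊆ G := by
  intro z hz
  by_contra hzG
  obtain ⟨φ, u, hu, huz⟩ := geometric_hahn_banach_closed_point hG hcl hzG
  have hz' : ‖z‖ ≤ ε / 2 := by simpa using hz
  have key : ∀ y : X, ‖y‖ ≤ ε → φ y ≤ u + ‖φ‖ * (ε / 2) := by
    intro y hy
    obtain ⟨g, hg, hyg⟩ := h y hy
    have h1 : φ (y - g) ≤ ‖φ‖ * (ε / 2) :=
      (le_abs_self _).trans ((φ.le_opNorm _).trans (by gcongr))
    have h2 := hu g hg
    rw [map_sub] at h1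
    linarith
  have hM : 0 ≤ u + ‖φ‖ * (ε / 2) := by simpa using key 0 (by simp [hε.le])
  have hn : ‖φ‖ ≤ (u + ‖φ‖ * (ε / 2)) / ε := by
    refine φ.opNorm_le_of_unit_norm (by positivity) ?_
    intro w hw
    rw [le_div_iff₀ hε, Real.norm_eq_abs]
    have h1 := key (ε • w) (by rw [norm_smul, hw, Real.norm_of_nonneg hε.le, mul_one])
    have h2 := key (-(ε • w)) (by rw [norm_neg, norm_smul, hw, Real.norm_of_nonneg hε.le, mul_one])
    simp only [map_neg, map_smul, smul_eq_mul] at h1 h2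
    rcases abs_cases (φ w) with ⟨h, _⟩ | ⟨h, _⟩ <;> rw [h] <;> nlinarith
  rw [le_div_iff₀ hε] at hn
  have h3 : φ z ≤ ‖φ‖ * (ε / 2) :=
    (le_abs_self _).trans ((φ.le_opNorm _).trans (by gcongr))
  linarith

lemma avoid_aux {C : Set X} (hC : Convex ℝ C) (hcl : IsClosed C) (h0 : (0 : X) ∈ C)
    (hs : Submodule.span ℝ C = ⊤) (hint : interior C = ∅) {ε : ℝ} (hε : 0 < ε) (F : Finset X) :
    ∃ y : X, ‖y‖ ≤ ε ∧ ∀ d ∈ F, ∀ z ∈ C, ε / 2 ≤ ‖y - d - z‖ := by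
  by_contra! hcon
  obtain ⟨m, hm, p, -, hF⟩ := finite_aux hC h0 hs F
  have hm1 : 0 < m + 1 := by linarith
  set e : X → X := fun x => (m + 1)⁻¹ • (x + p) with he
  have hec : Continuous e := by fun_prop
  have hsub : Metric.closedBall (0 : X) (ε / 2) ⊆ e ⁻¹' C := by
    refine cancel_aux ?_ (hcl.preimage hec) hε ?_
    · intro x hx y hy a b ha hb hab
      have : e (a • x + b • y) = a • e x + b • e y := by
        simp only [he]
        have : p = (a + b) • p := by rw [hab, one_smul]
        nth_rewrite 1 [this]
        module
      rw [mem_preimage, this]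
      exact hC hx hy ha hb hab
    · intro y hy
      obtain ⟨d, hd, z, hz, hlt⟩ := hcon y hy
      obtain ⟨c, hc, hdc⟩ := hF d hd
      obtain ⟨c', hc', h'⟩ := conv_add_aux hC hm one_pos hc hz
      refine ⟨d + z, ?_, by rw [← sub_sub]; exact hlt.le⟩
      have : e (d + z) = c' := by
        simp only [he]
        rw [show d + z + p = (d + p) + (1 : ℝ) • z by rw [one_smul]; abel, hdc, h', smul_smul,
          inv_mul_cancel₀ hm1.ne', one_smul]
      rw [mem_preimage, this]; exact hc'
  have hopen : IsOpen ((fun x : X => (m + 1) • x - p) ⁻¹' Metric.ball (0 : X) (ε / 2)) :=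
    Metric.isOpen_ball.preimage (by fun_prop)
  have hmem : (m + 1)⁻¹ • p ∈ interior C := by
    refine mem_interior.2 ⟨_, ?_, hopen, ?_⟩
    · intro x hx
      have := hsub (Metric.ball_subset_closedBall hx)
      simp only [he, mem_preimage, sub_add_cancel, smul_smul, inv_mul_cancel₀ hm1.ne', one_smul]
        at this
      exact this
    · simp [smul_smul, mul_inv_cancel₀ hm1.ne', hε]
  rw [hint] at hmem
  exact hmem

/-- In a separable space, a closed convex set with empty interior admits an arbitrarily small
sequence such that each translate of the set contains only finitely many terms. -/
lemma seq_aux [TopologicalSpace.SeparableSpace X] {C : Set X} (hC : Convex ℝ C)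
    (hcl : IsClosed C) (hint : interior C = ∅) {ε : ℝ} (hε : 0 < ε) :
    ∃ y : ℕ → X, (∀ n, ‖y n‖ ≤ ε) ∧ ∀ x : X, {n | y n - x ∈ C}.Finite := by
  rcases C.eq_empty_or_nonempty with rfl | ⟨c, hc⟩
  · exact ⟨fun _ => 0, by simp [hε.le], by simp⟩
  set C' : Set X := (fun x => x + c) ⁻¹' C with hC'
  have h0 : (0 : X) ∈ C' := by simpa [hC'] using hc
  by_cases hs : Submodule.span ℝ C' = ⊤
  · have hconv : Convex ℝ C' := hC.translate_preimage_left c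
    have hcl' : IsClosed C' := hcl.preimage (by fun_prop)
    have hint' : interior C' = ∅ := by
      have : C' = (Homeomorph.addRight c) ⁻¹' C := rfl
      rw [this, ← Homeomorph.preimage_interior, hint, preimage_empty]
    set d := TopologicalSpace.denseSeq X
    have hd : DenseRange d := TopologicalSpace.denseRange_denseSeq X
    classical
    choose y hy1 hy2 using fun n : ℕ =>
      avoid_aux hconv hcl' h0 hs hint' hε ((Finset.range (n + 1)).image d)
    refine ⟨y, hy1, fun x => ?_⟩
    obtain ⟨k, hk⟩ := hd.exists_dist_lt (x + c) (half_pos hε)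
    refine (Set.finite_lt_nat k).subset ?_
    intro n hn
    by_contra hkn
    simp only [mem_ofPred_eq, not_lt] at hkn
    have := hy2 n (d k) (Finset.mem_image_of_mem d (Finset.mem_range.2 (by omega)))
      (y n - x - c) (by simpa [hC'] using hn)
    rw [dist_eq_norm] at hk
    rw [show y n - d k - (y n - x - c) = x + c - d k by abel] at this
    linarith
  · obtain ⟨v, hv⟩ : ∃ v, v ∉ Submodule.span ℝ C' := by
      by_contra! h
      exact hs (eq_top_iff.2 fun x _ => h x)
    have hv0 : v ≠ 0 := by rintro rfl; exact hv (zero_mem _)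
    have hvn : 0 < ‖v‖ := norm_pos_iff.2 hv0
    refine ⟨fun n => (ε / ‖v‖ / (n + 1)) • v, ?_, ?_⟩
    · intro n
      rw [norm_smul, Real.norm_of_nonneg (by positivity)]
      rw [div_mul_eq_mul_div, div_mul_cancel₀ _ hvn.ne']
      exact div_le_self hε.le (by linarith [Nat.cast_nonneg (α := ℝ) n])
    · intro x
      refine Set.Subsingleton.finite ?_
      intro n hn k hk
      by_contra hnk
      simp only [mem_ofPred_eq] at hn hk
      have h1 : (ε / ‖v‖ / (n + 1)) • v - x - c ∈ Submodule.span ℝ C' :=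
        Submodule.subset_span (by simpa [hC'] using hn)
      have h2 : (ε / ‖v‖ / (k + 1)) • v - x - c ∈ Submodule.span ℝ C' :=
        Submodule.subset_span (by simpa [hC'] using hk)
      have h3 := Submodule.sub_mem _ h1 h2
      rw [show (ε / ‖v‖ / (n + 1)) • v - x - c - ((ε / ‖v‖ / (k + 1)) • v - x - c)
        = (ε / ‖v‖ / (n + 1) - ε / ‖v‖ / (k + 1)) • v by module] at h3
      rw [Submodule.smul_mem_iff] at h3
      · exact hv h3
      · intro h
        apply hnk
        have : (n : ℝ) + 1 = k + 1 := by
          have hp : (0 : ℝ) < n + 1 := by positivity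
          have hq : (0 : ℝ) < k + 1 := by positivity
          field_simp at h
          have h' : ε * ((k : ℝ) + 1 - (n + 1)) = 0 := by rw [h]; ring
          rcases mul_eq_zero.1 h' with h' | h' <;> linarith
        exact_mod_cast (add_right_cancel this)

/-- Weak cluster points of bounded sequences in reflexive spaces. -/
lemma weak_aux (hrefl : IsReflexiveSpace X) (x : ℕ → X) (R : ℝ) (hx : ∀ᶠ n in atTop, ‖x n‖ ≤ R) :
    ∃ z : X, ∀ A : Set X, Convex ℝ A → IsClosed A → (∀ᶠ n in atTop, x n ∈ A) → z ∈ A := by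
  let J : X → WeakDual ℝ (StrongDual ℝ X) := fun x =>
    WeakDual.toStrongDual.symm (NormedSpace.inclusionInDoubleDual ℝ X x)
  have hcomp := WeakDual.isCompact_closedBall (𝕜 := ℝ) (E := StrongDual ℝ X) 0 R
  have hev : ∃ᶠ n in atTop, J (x n) ∈ (WeakDual.toStrongDual ⁻¹'
      Metric.closedBall (0 : StrongDual ℝ (StrongDual ℝ X)) R) := by
    refine Eventually.frequently ?_
    filter_upwards [hx] with n hn
    simp only [J, mem_preimage, LinearEquiv.apply_symm_apply]
    exact (mem_closedBall_zero_iff (E := StrongDual ℝ (StrongDual ℝ X))).2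
      ((NormedSpace.double_dual_bound ℝ X (x n)).trans hn)
  obtain ⟨Φ, -, hΦ⟩ := hcomp.exists_mapClusterPt_of_frequently hev
  obtain ⟨z, hz⟩ := hrefl (WeakDual.toStrongDual Φ)
  refine ⟨z, fun A hA hcl hAe => ?_⟩
  by_contra hzA
  obtain ⟨φ, u, hu, huz⟩ := geometric_hahn_banach_closed_point hA hcl hzA
  have h1 : MapClusterPt (Φ φ) atTop ((fun Ψ : WeakDual ℝ (StrongDual ℝ X) => Ψ φ) ∘
      fun n => J (x n)) :=
    MapClusterPt.tendsto_comp (WeakDual.eval_continuous φ).continuousAt hΦ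
  have h2 : Φ φ = φ z := by
    have := congrArg (fun Ψ : StrongDual ℝ (StrongDual ℝ X) => Ψ φ) hz
    simpa using this.symm
  have h3 : ∃ᶠ n in atTop, u < φ (x n) := by
    have := h1.frequently (p := fun t => u < t) (Ioi_mem_nhds (by rw [h2]; exact huz))
    exact this
  obtain ⟨n, hn1, hn2⟩ := (h3.and_eventually hAe).exists
  exact absurd (hu _ hn2) (not_lt.2 hn1.le)

end Geometry

section Ptak

/-- Pták's lemma. -/
lemma ptak_aux (S : Set (ℕ → Bool)) (hS : ∀ a ∈ closure S, {n | a n = true}.Finite)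
    {δ : ℝ} (hδ : 0 < δ) :
    ∃ ν : Measure ℕ, IsProbabilityMeasure ν ∧ ∀ a ∈ S, ν.real {n | a n = true} ≤ δ := by
  classical
  let K := closure S
  have : CompactSpace K := isCompact_iff_compactSpace.1 isClosed_closure.isCompact
  let G : Set C(K, ℝ) := {g | ∀ a, g a < δ}
  let W : Set C(K, ℝ) := {h | ∃ ν : Measure ℕ, IsProbabilityMeasure ν ∧
    ∀ a : K, h a = ν.real {n | a.1 n = true}}
  by_cases hd : Disjoint G W
  · exfalso
    have hGc : Convex ℝ G := by
      intro g hg h hh a b ha hb hab x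
      have h1 := hg x
      have h2 := hh x
      simp only [ContinuousMap.add_apply, ContinuousMap.smul_apply, smul_eq_mul]
      exact convex_Iio δ h1 h2 ha hb hab
    have hGo : IsOpen G := by
      have := ContinuousMap.isOpen_setOfPred_mapsTo (X := K) (Y := ℝ) isCompact_univ
        (isOpen_Iio (a := δ))
      convert this using 1
      ext g
      simp [G, MapsTo]
    have hWc : Convex ℝ W := by
      rintro g ⟨ν, hν, hg⟩ h ⟨ρ, hρ, hh⟩ a b ha hb hab
      refine ⟨ENNReal.ofReal a • ν + ENNReal.ofReal b • ρ, ⟨?_⟩, ?_⟩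
      · simp [← ENNReal.ofReal_add ha hb, hab]
      · intro x
        have : IsFiniteMeasure (ENNReal.ofReal a • ν) := ν.smul_finite (by simp)
        have : IsFiniteMeasure (ENNReal.ofReal b • ρ) := ρ.smul_finite (by simp)
        rw [measureReal_add_apply, measureReal_ennreal_smul_apply, measureReal_ennreal_smul_apply,
          ENNReal.toReal_ofReal ha, ENNReal.toReal_ofReal hb, ← hg, ← hh]
        rfl
    obtain ⟨Λ, s, hΛ1, hΛ2⟩ := geometric_hahn_banach_open hGc hGo hWc hd
    have hs : 0 < s := by
      have := hΛ1 0 (fun a => by simpa using hδ)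
      simpa using this
    have hpos : ∀ g : C(K, ℝ), (∀ a, 0 ≤ g a) → 0 ≤ Λ g := by
      intro g hg
      by_contra hneg
      push Not at hneg
      have := hΛ1 ((s / Λ g) • g) (fun a => by
        have : s / Λ g ≤ 0 := (div_neg_of_pos_of_neg hs hneg).le
        simp only [ContinuousMap.smul_apply, smul_eq_mul]
        nlinarith [hg a])
      rw [map_smul, smul_eq_mul, div_mul_cancel₀ _ hneg.ne] at this
      exact lt_irrefl _ this
    let : MeasurableSpace K := borel K
    have : BorelSpace K := ⟨rfl⟩
    let T0 : CompactlySupportedContinuousMap K ℝ →ₗ[ℝ] ℝ :=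
      { toFun := fun g => Λ g.toContinuousMap
        map_add' := fun g h => by
          rw [← map_add]; rfl
        map_smul' := fun r g => by
          rw [RingHom.id_apply, ← map_smul]; rfl }
    let T : CompactlySupportedContinuousMap K ℝ →ₚ[ℝ] ℝ :=
      PositiveLinearMap.mk₀ T0 (fun g hg => hpos _ (fun a => hg a))
    let μ := RealRMK.rieszMeasure T
    let e : ℕ → C(K, ℝ) := fun n =>
      ⟨fun a => if a.1 n = true then 1 else 0, by
        have h1 : Continuous (fun a : K => a.1 n) := (continuous_apply n).comp continuous_subtype_val
        exact (continuous_of_discreteTopology (f := fun b : Bool => if b = true then (1 : ℝ) else 0)).comp h1⟩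
    have heW : ∀ n, e n ∈ W := by
      intro n
      refine ⟨Measure.dirac n, inferInstance, fun a => ?_⟩
      by_cases h : a.1 n = true <;> simp [e, h, measureReal_def]
    have hint : ∀ n, s ≤ ∫ a, e n a ∂μ := by
      intro n
      have := RealRMK.integral_rieszMeasure T
        (CompactlySupportedContinuousMap.continuousMapEquiv (e n))
      have h2 := hΛ2 _ (heW n)
      calc s ≤ Λ (e n) := h2
        _ = _ := this.symm
    have hlim : Tendsto (fun n => ∫ a, e n a ∂μ) atTop (𝓝 (∫ a : K, (0 : ℝ) ∂μ)) := by
      refine tendsto_integral_of_dominated_convergence (fun _ => 1) ?_ ?_ ?_ ?_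
      · intro n
        exact (e n).continuous.aestronglyMeasurable
      · exact integrable_const _
      · intro n
        refine Eventually.of_forall fun a => ?_
        by_cases h : a.1 n = true <;> simp [e, h]
      · refine Eventually.of_forall fun a => ?_
        refine tendsto_const_nhds.congr' ?_
        have := (hS a.1 a.2).bddAbove
        obtain ⟨N, hN⟩ := this
        filter_upwards [eventually_gt_atTop N] with n hn
        have : ¬ a.1 n = true := fun h => absurd (hN h) (not_le.2 hn)
        simp [e, this]
    have := ge_of_tendsto' hlim hint
    simp at this
    linarith
  · rw [Set.not_disjoint_iff] at hd
    obtain ⟨h, hG, ν, hν, hh⟩ := hd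
    exact ⟨ν, hν, fun a ha => by
      have := hG ⟨a, subset_closure ha⟩
      rw [hh] at this
      exact this.le⟩

end Ptak

section Small

lemma resample_aux (ν : ℕ → Measure ℕ) [∀ i, IsProbabilityMeasure (ν i)] (k : ℕ) :
    ((Measure.infinitePi ν).prod (ν k)).map
      (fun p : (ℕ → ℕ) × ℕ => Function.update p.1 k p.2) = Measure.infinitePi ν := by
  have hmeas : Measurable (fun p : (ℕ → ℕ) × ℕ => Function.update p.1 k p.2) := by
    refine measurable_pi_lambda _ fun i => ?_
    by_cases h : i = k
    · subst h; simpa using measurable_snd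
    · simp only [Function.update_of_ne h]
      exact (measurable_pi_apply i).comp measurable_fst
  refine Measure.eq_infinitePi ν fun s t ht => ?_
  rw [Measure.map_apply hmeas (MeasurableSet.pi s.countable_toSet (fun i _ => ht i))]
  by_cases hk : k ∈ s
  · have : (fun p : (ℕ → ℕ) × ℕ => Function.update p.1 k p.2) ⁻¹' (Set.pi s t)
        = (Set.pi (s.erase k : Finset ℕ) t) ×ˢ (t k) := by
      ext ⟨ω, n⟩
      simp only [mem_preimage, Set.mem_pi, mem_prod, Finset.mem_coe, Finset.mem_erase]
      constructor
      · intro h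
        refine ⟨fun i hi => ?_, by simpa using h k hk⟩
        simpa [Function.update_of_ne hi.1] using h i hi.2
      · rintro ⟨h1, h2⟩ i hi
        by_cases h : i = k
        · subst h; simpa using h2
        · simpa [Function.update_of_ne h] using h1 i ⟨h, hi⟩
    rw [this, Measure.prod_prod, Measure.infinitePi_pi _ (fun i _ => ht i),
      Finset.prod_erase_mul _ _ hk]
  · have : (fun p : (ℕ → ℕ) × ℕ => Function.update p.1 k p.2) ⁻¹' (Set.pi s t)
        = (Set.pi s t) ×ˢ (univ : Set ℕ) := by
      ext ⟨ω, n⟩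
      simp only [mem_preimage, Set.mem_pi, mem_prod, Finset.mem_coe, mem_univ, and_true]
      refine forall₂_congr fun i hi => ?_
      have h : i ≠ k := fun h => hk (h ▸ hi)
      simp [Function.update_of_ne h]
    rw [this, Measure.prod_prod, Measure.infinitePi_pi _ (fun i _ => ht i)]
    simp

variable {X : Type*} [NormedAddCommGroup X] [NormedSpace ℝ X]

/-- Sets which can be uniformly avoided by small discrete measures. -/
def SmallSet (A : Set X) : Prop :=
  ∀ ε : ℝ, 0 < ε → ∀ δ : ℝ, 0 < δ → ∃ y : ℕ → X, (∀ n, ‖y n‖ ≤ ε) ∧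
    ∃ ν : Measure ℕ, IsProbabilityMeasure ν ∧ ∀ x : X, ν.real {n | y n - x ∈ A} ≤ δ

lemma small_measure [CompleteSpace X] [MeasurableSpace X] [BorelSpace X]
    (A : ℕ → Set X) (hm : ∀ j, MeasurableSet (A j)) (hA : ∀ j, SmallSet (A j)) :
    ∃ μ : Measure X, IsProbabilityMeasure μ ∧ ∀ j, ∀ x : X, μ ((fun y => x + y) '' A j) = 0 := by
  choose y hy ν hν hνA using fun k : ℕ => hA k.unpair.1 ((1 / 2 : ℝ) ^ k) (by positivity)
    (1 / ((k.unpair.2 : ℝ) + 1)) (by positivity)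
  have hsum : Summable (fun k : ℕ => (1 / 2 : ℝ) ^ k) := summable_geometric_two
  let S : (ℕ → ℕ) → X := fun ω => ∑' k, y k (ω k)
  have hScont : Continuous S := by
    refine continuous_tsum (fun k => ?_) hsum (fun k ω => hy k _)
    exact (continuous_of_discreteTopology (f := y k)).comp (continuous_apply k)
  have hSm : Measurable S := hScont.measurable
  have hsm : ∀ ω : ℕ → ℕ, Summable (fun k => y k (ω k)) := fun ω =>
    Summable.of_norm_bounded hsum (fun k => hy k _)
  have hSup : ∀ (ω : ℕ → ℕ) (k n : ℕ),
      S (Function.update ω k n) = y k n - (y k (ω k) - S ω) := by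
    intro ω k n
    have h1 : S (Function.update ω k n) - S ω = y k n - y k (ω k) := by
      simp only [S]
      rw [← (hsm _).tsum_sub (hsm _), tsum_eq_single k]
      · simp
      · intro b hb
        simp [Function.update_of_ne hb]
    rw [sub_sub_eq_add_sub, ← sub_add_eq_add_sub, ← h1]
    abel
  let P := Measure.infinitePi ν
  refine ⟨P.map S, Measure.isProbabilityMeasure_map hSm.aemeasurable, fun j x => ?_⟩
  have himg : ((fun y => x + y) '' A j) = (fun y => y - x) ⁻¹' A j := by
    ext z
    constructor
    · rintro ⟨a, ha, rfl⟩; simpa using ha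
    · intro hz; exact ⟨z - x, hz, by simp⟩
  have hBm : MeasurableSet ((fun y => y - x) ⁻¹' A j) := by
    have : Measurable (fun y : X => y - x) := (continuous_id.sub continuous_const).measurable
    exact this (hm j)
  rw [himg, Measure.map_apply hSm hBm]
  set E : Set (ℕ → ℕ) := S ⁻¹' ((fun y => y - x) ⁻¹' A j) with hE
  have hEm : MeasurableSet E := hSm hBm
  have hbound : ∀ i : ℕ, P E ≤ ENNReal.ofReal (1 / ((i : ℝ) + 1)) := by
    intro i
    let k := Nat.pair j i
    have hk : k.unpair = (j, i) := Nat.unpair_pair j i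
    have hmeas : Measurable (fun p : (ℕ → ℕ) × ℕ => Function.update p.1 k p.2) := by
      refine measurable_pi_lambda _ fun i => ?_
      by_cases h : i = k
      · subst h; simpa using measurable_snd
      · simp only [Function.update_of_ne h]
        exact (measurable_pi_apply i).comp measurable_fst
    have h1 : P E = (P.prod (ν k)) ((fun p : (ℕ → ℕ) × ℕ => Function.update p.1 k p.2) ⁻¹' E) := by
      rw [← Measure.map_apply hmeas hEm, resample_aux ν k]
    rw [h1, Measure.prod_apply (hmeas hEm)]
    calc _ ≤ ∫⁻ _ : ℕ → ℕ, ENNReal.ofReal (1 / ((i : ℝ) + 1)) ∂P := by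
          refine lintegral_mono fun ω => ?_
          have h2 := hνA k (y k (ω k) - S ω + x)
          rw [hk] at h2
          have h3 : (Prod.mk ω ⁻¹' ((fun p : (ℕ → ℕ) × ℕ => Function.update p.1 k p.2) ⁻¹' E))
              = {n | y k n - (y k (ω k) - S ω + x) ∈ A j} := by
            ext n
            simp only [mem_preimage, hE, hSup, mem_ofPred_eq, sub_sub]
          rw [h3]
          rw [measureReal_def] at h2
          exact (ENNReal.le_ofReal_iff_toReal_le (measure_ne_top _ _) (by positivity)).2 h2
      _ = _ := by simp
  refine le_antisymm (ge_of_tendsto' (x := atTop) (f := fun i : ℕ => ENNReal.ofReal (1 / ((i : ℝ) + 1))) ?_ hbound) zero_le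
  have := ENNReal.tendsto_ofReal (tendsto_one_div_add_atTop_nhds_zero_nat (𝕜 := ℝ))
  simpa using this

/-- Covered by countably many measurable small sets. -/
def SigmaSmall [MeasurableSpace X] (E : Set X) : Prop :=
  ∃ A : ℕ → Set X, (∀ j, MeasurableSet (A j)) ∧ (∀ j, SmallSet (A j)) ∧ E ⊆ ⋃ j, A j

lemma SigmaSmall.mono [MeasurableSpace X] {E F : Set X} (h : SigmaSmall F) (hEF : E ⊆ F) :
    SigmaSmall E := by
  obtain ⟨A, h1, h2, h3⟩ := h
  exact ⟨A, h1, h2, hEF.trans h3⟩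

lemma SigmaSmall.iUnion [MeasurableSpace X] {E : ℕ → Set X} (h : ∀ i, SigmaSmall (E i)) :
    SigmaSmall (⋃ i, E i) := by
  choose A h1 h2 h3 using h
  refine ⟨fun k => A k.unpair.1 k.unpair.2, fun _ => h1 _ _, fun _ => h2 _ _, ?_⟩
  refine iUnion_subset fun i x hx => ?_
  obtain ⟨j, hj⟩ := mem_iUnion.1 (h3 i hx)
  exact mem_iUnion.2 ⟨Nat.pair i j, by simpa using hj⟩

lemma SmallSet.sigmaSmall [MeasurableSpace X] {A : Set X} (h : SmallSet A)
    (hm : MeasurableSet A) : SigmaSmall A :=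
  ⟨fun _ => A, fun _ => hm, fun _ => h, fun _ hx => mem_iUnion.2 ⟨0, hx⟩⟩

lemma SigmaSmall.haarNull [CompleteSpace X] [MeasurableSpace X] [BorelSpace X] {E : Set X}
    (h : SigmaSmall E) : HaarNull E := by
  obtain ⟨A, h1, h2, h3⟩ := h
  obtain ⟨μ, hμ, h⟩ := small_measure A h1 h2
  refine ⟨_, h3, MeasurableSet.iUnion h1, μ, hμ, fun x => ?_⟩
  rw [image_iUnion]
  exact measure_iUnion_null fun j => h j x

end Small

section Final

variable {X : Type*} [NormedAddCommGroup X] [NormedSpace ℝ X]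

/-- Matoušková's theorem, in the form needed here. -/
lemma small_convex [TopologicalSpace.SeparableSpace X] (hrefl : IsReflexiveSpace X) {C : Set X}
    (hC : Convex ℝ C) (hcl : IsClosed C) (hint : interior C = ∅) {R : ℝ}
    (hR : ∀ z ∈ C, ‖z‖ ≤ R) : SmallSet C := by
  classical
  intro ε hε δ hδ
  obtain ⟨y, hy, hfin⟩ := seq_aux hC hcl hint hε
  refine ⟨y, hy, ?_⟩
  suffices hS : ∀ a ∈ closure (range fun x : X => fun n => decide (y n - x ∈ C)),
      {n | a n = true}.Finite by
    obtain ⟨ν, hν, h⟩ := ptak_aux _ hS hδ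
    refine ⟨ν, hν, fun x => ?_⟩
    simpa using h _ (mem_range_self x)
  · intro a ha
    by_contra hinf
    have hne : {n | a n = true}.Infinite := hinf
    obtain ⟨n0, hn0⟩ := hne.nonempty
    have happ : ∀ N : ℕ, ∃ x : X, ∀ n < N, decide (y n - x ∈ C) = a n := by
      intro N
      have hopen : IsOpen (Set.pi (Iio N) (fun n => ({a n} : Set Bool))) :=
        isOpen_set_pi (finite_Iio N) (fun _ _ => isOpen_discrete _)
      obtain ⟨b, hb, x, rfl⟩ := mem_closure_iff.1 ha _ hopen (fun n _ => rfl)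
      exact ⟨x, fun n hn => hb n hn⟩
    choose x hx using happ
    have hmem : ∀ n, a n = true → ∀ᶠ N in atTop, y n - x N ∈ C := by
      intro n hn
      filter_upwards [eventually_gt_atTop n] with N hN
      have := hx N n hN
      rw [hn] at this
      exact of_decide_eq_true this
    obtain ⟨z, hz⟩ := weak_aux hrefl x (R + ‖y n0‖) (by
      filter_upwards [hmem n0 hn0] with N hN
      have h1 := hR _ hN
      have h2 : ‖x N‖ ≤ ‖y n0 - x N‖ + ‖y n0‖ := by
        have := norm_sub_le (y n0) (y n0 - x N)
        rw [sub_sub_cancel] at this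
        linarith
      linarith)
    refine hne ((hfin z).subset fun n hn => ?_)
    refine hz ((fun w => y n - w) ⁻¹' C) ?_ (hcl.preimage (by fun_prop)) (hmem n hn)
    intro u hu v hv s t hs ht hst
    have : y n - (s • u + t • v) = s • (y n - u) + t • (y n - v) := by
      have h1 : y n = (s + t) • y n := by rw [hst, one_smul]
      nth_rewrite 1 [h1]
      module
    rw [mem_preimage, this]
    exact hC hu hv hs ht hst

/-- Three points of a line which meets the interior cannot all be frontier points. -/
lemma line_aux {C : Set X} (hC : Convex ℝ C) {w v : X} {s1 s2 s3 t : ℝ} (h12 : s1 < s2)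
    (h23 : s2 < s3) (h1 : w + s1 • v ∈ frontier C) (h2 : w + s2 • v ∈ frontier C)
    (h3 : w + s3 • v ∈ frontier C) (ht : w + t • v ∈ interior C) : False := by
  have key : ∀ s, w + s • v ∈ frontier C → ∀ r ∈ Ioo (0 : ℝ) 1, s2 = r * t + (1 - r) * s →
      False := by
    intro s hs r hr hsr
    have hmem : w + s2 • v ∈ openSegment ℝ (w + t • v) (w + s • v) := by
      refine ⟨r, 1 - r, hr.1, by linarith [hr.2], by ring, ?_⟩
      rw [hsr]; module
    exact h2.2 (hC.openSegment_interior_closure_subset_interior ht hs.1 hmem)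
  rcases lt_trichotomy t s2 with h | h | h
  · have hp : 0 < s3 - t := by linarith
    refine key s3 h3 ((s3 - s2) / (s3 - t)) ⟨by apply div_pos <;> linarith, ?_⟩ ?_
    · rw [div_lt_one hp]; linarith
    · field_simp; ring
  · rw [h] at ht; exact h2.2 ht
  · have hp : 0 < t - s1 := by linarith
    refine key s1 h1 ((s2 - s1) / (t - s1)) ⟨by apply div_pos <;> linarith, ?_⟩ ?_
    · rw [div_lt_one hp]; linarith
    · field_simp; ring

lemma small_frontier {C : Set X} (hC : Convex ℝ C) (v : X) :
    SmallSet {x | x ∈ frontier C ∧ ∃ t : ℝ, x + t • v ∈ interior C} := by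
  classical
  intro ε hε δ hδ
  set c : ℝ := ε / (‖v‖ + 1) with hc
  have hcpos : 0 < c := by positivity
  let y : ℕ → X := fun n => (c / (n + 1)) • v
  have hcv : c * ‖v‖ ≤ ε := by
    rw [hc, div_mul_eq_mul_div, div_le_iff₀ (by positivity)]
    nlinarith [norm_nonneg v]
  have hy : ∀ n, ‖y n‖ ≤ ε := by
    intro n
    simp only [y]
    rw [norm_smul, Real.norm_of_nonneg (by positivity)]
    have : c / ((n : ℝ) + 1) ≤ c := div_le_self hcpos.le (by linarith [Nat.cast_nonneg (α := ℝ) n])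
    exact (mul_le_mul_of_nonneg_right this (norm_nonneg v)).trans hcv
  let K : Set (ℕ → Bool) := ⋂ (i : ℕ) (j : ℕ) (k : ℕ) (_ : i < j) (_ : j < k),
    {a | ¬ (a i = true ∧ a j = true ∧ a k = true)}
  have hK : IsClosed K := by
    refine isClosed_iInter fun i => isClosed_iInter fun j => isClosed_iInter fun k =>
      isClosed_iInter fun _ => isClosed_iInter fun _ => ?_
    have hcts : Continuous (fun a : ℕ → Bool => (a i, a j, a k)) := by fun_prop
    exact (isClosed_discrete {p : Bool × Bool × Bool |
      ¬ (p.1 = true ∧ p.2.1 = true ∧ p.2.2 = true)}).preimage hcts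
  refine ⟨y, hy, ?_⟩
  suffices hS : ∀ a ∈ closure K, {n | a n = true}.Finite by
    obtain ⟨ν, hν, h⟩ := ptak_aux K hS hδ
    refine ⟨ν, hν, fun x => ?_⟩
    have hmem : (fun n => decide (y n - x ∈ {x | x ∈ frontier C ∧
        ∃ t : ℝ, x + t • v ∈ interior C})) ∈ K := by
      simp only [K, mem_iInter]
      rintro i j k hij hjk ⟨hi, hj, hk⟩
      obtain ⟨hi, -⟩ := of_decide_eq_true hi
      obtain ⟨hj, t, ht⟩ := of_decide_eq_true hj
      obtain ⟨hk, -⟩ := of_decide_eq_true hk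
      have hmono : ∀ m n : ℕ, m < n → c / ((n : ℝ) + 1) < c / (m + 1) := by
        intro m n hmn
        have : (m : ℝ) < n := by exact_mod_cast hmn
        have : (0 : ℝ) ≤ m := by positivity
        apply div_lt_div_of_pos_left hcpos <;> linarith
      refine line_aux hC (w := -x) (v := v) (t := c / (j + 1) + t) (hmono j k hjk) (hmono i j hij)
        ?_ ?_ ?_ ?_
      · convert hk using 1; simp only [y]; abel
      · convert hj using 1; simp only [y]; abel
      · convert hi using 1; simp only [y]; abel
      · convert ht using 1; simp only [y]; module
    simpa using h _ hmem
  · intro a ha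
    rw [hK.closure_eq] at ha
    by_contra hinf
    have hinf : {n | a n = true}.Infinite := hinf
    obtain ⟨i, hi, -⟩ := hinf.exists_gt 0
    obtain ⟨j, hj, hij⟩ := hinf.exists_gt i
    obtain ⟨k, hk, hjk⟩ := hinf.exists_gt j
    simp only [K, mem_iInter] at ha
    exact ha i j k hij hjk ⟨hi, hj, hk⟩

lemma sigma_frontier [TopologicalSpace.SeparableSpace X] [MeasurableSpace X] [BorelSpace X]
    {C : Set X} (hC : Convex ℝ C) (hint : (interior C).Nonempty) : SigmaSmall (frontier C) := by
  let d := TopologicalSpace.denseSeq X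
  have hd : DenseRange d := TopologicalSpace.denseRange_denseSeq X
  refine SigmaSmall.mono (F := ⋃ n, {x | x ∈ frontier C ∧ ∃ t : ℝ, x + t • d n ∈ interior C})
    (SigmaSmall.iUnion fun n => (small_frontier hC (d n)).sigmaSmall ?_) ?_
  · have : {x | x ∈ frontier C ∧ ∃ t : ℝ, x + t • d n ∈ interior C} =
        frontier C ∩ ⋃ t : ℝ, (fun x => x + t • d n) ⁻¹' interior C := by
      ext x; simp
    rw [this]
    refine isClosed_frontier.measurableSet.inter (IsOpen.measurableSet ?_)
    exact isOpen_iUnion fun t => isOpen_interior.preimage (by fun_prop)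
  · intro x hx
    obtain ⟨c, hc⟩ := hint
    have hop : IsOpen ((fun v => x + v) ⁻¹' interior C) := isOpen_interior.preimage (by fun_prop)
    obtain ⟨n, hn⟩ := hd.exists_mem_open hop ⟨c - x, by simpa using hc⟩
    exact mem_iUnion.2 ⟨n, hx, 1, by simpa using hn⟩

lemma sigma_nowhere [TopologicalSpace.SeparableSpace X] [MeasurableSpace X] [BorelSpace X]
    (hrefl : IsReflexiveSpace X) {C : Set X} (hC : Convex ℝ C) (hint : interior (closure C) = ∅) :
    SigmaSmall (closure C) := by
  refine SigmaSmall.mono (F := ⋃ n : ℕ, closure C ∩ Metric.closedBall 0 n)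
    (SigmaSmall.iUnion fun n => SmallSet.sigmaSmall ?_ ?_) ?_
  · refine small_convex hrefl (hC.closure.inter (convex_closedBall _ _))
      (isClosed_closure.inter Metric.isClosed_closedBall) ?_ (R := n) ?_
    · rw [interior_inter, hint, empty_inter]
    · intro z hz
      simpa using hz.2
  · exact (isClosed_closure.inter Metric.isClosed_closedBall).measurableSet
  · intro x hx
    obtain ⟨n, hn⟩ := exists_nat_ge ‖x‖
    exact mem_iUnion.2 ⟨n, hx, by simpa using hn⟩

lemma dense_of_haarNull [TopologicalSpace.SeparableSpace X] [MeasurableSpace X]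
    {E : Set X} (h : HaarNull Eᶜ) : Dense E := by
  obtain ⟨B, hEB, -, μ, hμ, h0⟩ := h
  rw [dense_iff_inter_open]
  intro U hU hUne
  by_contra hcon
  have hUB : U ⊆ B := fun u hu => hEB fun huE => hcon ⟨u, hu, huE⟩
  obtain ⟨u, hu⟩ := hUne
  let d := TopologicalSpace.denseSeq X
  have hd : DenseRange d := TopologicalSpace.denseRange_denseSeq X
  have hcov : (univ : Set X) ⊆ ⋃ n, (fun y => d n + y) '' B := by
    intro z _
    have hop : IsOpen ((fun v => z - v) ⁻¹' U) := hU.preimage (by fun_prop)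
    obtain ⟨n, hn⟩ := hd.exists_mem_open hop ⟨z - u, by simpa using hu⟩
    exact mem_iUnion.2 ⟨n, z - d n, hUB hn, by simp⟩
  have : μ univ = 0 := measure_mono_null hcov (measure_iUnion_null fun n => h0 _)
  rw [measure_univ] at this
  exact one_ne_zero this

end Final

/-- On a reflexive separable Banach space, a quasiconvex function is densely continuous
if and only if its set of points of discontinuity is Haar null. -/
theorem stmt_5 {X : Type*} [NormedAddCommGroup X] [NormedSpace ℝ X] [CompleteSpace X]
    [TopologicalSpace.SeparableSpace X] [MeasurableSpace X] [BorelSpace X]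
    (hrefl : IsReflexiveSpace X) (f : X → ℝ) (hq : QuasiconvexFun f) :
    DenselyContinuous f ↔ HaarNull {x : X | ¬ ContinuousAt f x} := by
  constructor
  · intro hdc
    have hconv : ∀ q : ℝ, Convex ℝ {x | f x < q} := by
      intro q x hx y hy a b ha hb hab
      have h := hq x y a ⟨ha, by linarith⟩
      rw [show (1 : ℝ) - a = b by linarith] at h
      exact h.trans_lt (max_lt hx hy)
    let good : ℝ → Prop := fun q =>
      (interior {x | f x < q}).Nonempty ∨ interior (closure {x | f x < q}) = ∅
    have hgood : ∀ q q' : ℝ, q < q' → good q ∨ good q' := by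
      intro q q' hqq
      by_cases h : interior (closure {x | f x < q}) = ∅
      · exact Or.inl (Or.inr h)
      · right; left
        obtain ⟨x, hxU, hx⟩ := hdc.inter_open_nonempty _ isOpen_interior
          (nonempty_iff_ne_empty.2 h)
        have hxc : ContinuousAt f x := hx
        have hfx : f x ≤ q := by
          by_contra hlt
          push Not at hlt
          have h1 : ∀ᶠ y in 𝓝 x, q < f y := hxc.eventually_const_lt hlt
          have h2 : ∃ᶠ y in 𝓝 x, f y < q := mem_closure_iff_frequently.1 (interior_subset hxU)
          obtain ⟨y, hy1, hy2⟩ := (h2.and_eventually h1).exists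
          exact lt_asymm hy1 hy2
        exact ⟨x, mem_interior_iff_mem_nhds.2 (hxc.eventually_lt_const (hfx.trans_lt hqq))⟩
    have hsig : ∀ q, good q → SigmaSmall (frontier {x | f x < q}) := by
      rintro q (h | h)
      · exact sigma_frontier (hconv q) h
      · exact (sigma_nowhere hrefl (hconv q) h).mono frontier_subset_closure
    obtain ⟨r, hr⟩ := exists_surjective_nat ℚ
    refine SigmaSmall.haarNull (SigmaSmall.mono
      (F := ⋃ n : ℕ, {x | good (r n) ∧ x ∈ frontier {x | f x < r n}})
      (SigmaSmall.iUnion fun n => ?_) ?_)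
    · by_cases hg : good (r n)
      · exact (hsig _ hg).mono fun x hx => hx.2
      · refine ⟨fun _ => ∅, fun _ => MeasurableSet.empty, fun _ ε hε δ hδ => ?_, ?_⟩
        · exact ⟨fun _ => 0, fun _ => by simpa using hε.le, Measure.dirac 0, inferInstance,
            fun x => by simpa using hδ.le⟩
        · intro x hx
          exact absurd hx.1 hg
    · intro x hx
      have hpick : ∀ a b : ℝ, a < b → (∀ q : ℝ, a < q → q < b → x ∈ frontier {x | f x < q}) →
          x ∈ ⋃ n : ℕ, {x | good (r n) ∧ x ∈ frontier {x | f x < r n}} := by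
        intro a b hab hall
        obtain ⟨q1, ha1, h1b⟩ := exists_rat_btwn hab
        obtain ⟨q2, h12, h2b⟩ := exists_rat_btwn h1b
        rcases hgood q1 q2 h12 with hg | hg
        · obtain ⟨n, hn⟩ := hr q1
          exact mem_iUnion.2 ⟨n, by rw [hn]; exact ⟨hg, hall _ ha1 h1b⟩⟩
        · obtain ⟨n, hn⟩ := hr q2
          exact mem_iUnion.2 ⟨n, by rw [hn]; exact ⟨hg, hall _ (ha1.trans h12) h2b⟩⟩
      have hx' : ¬ Tendsto f (𝓝 x) (𝓝 (f x)) := hx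
      rw [tendsto_order, not_and_or] at hx'
      rcases hx' with h | h
      · push Not at h
        obtain ⟨a, ha, hfr⟩ := h
        refine hpick a (f x) ha fun q haq hqx => ⟨?_, fun hmem => ?_⟩
        · rw [mem_closure_iff_frequently]
          exact hfr.mono fun y hy => (not_lt.1 (by simpa using hy)).trans_lt haq
        · have : x ∈ {x | f x < q} := interior_subset hmem
          exact lt_asymm this hqx
      · push Not at h
        obtain ⟨b, hb, hfr⟩ := h
        refine hpick (f x) b hb fun q hxq hqb => ⟨subset_closure hxq, fun hmem => ?_⟩
        have h1 : ∀ᶠ y in 𝓝 x, f y < q := mem_interior_iff_mem_nhds.1 hmem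
        obtain ⟨y, hy1, hy2⟩ := (hfr.and_eventually h1).exists
        exact absurd (hy2.trans hqb) (by simpa using hy1)
  · intro h
    exact dense_of_haarNull h
end
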